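/- Let Ω ⊂ ℝ² be a closed bounded rectangle and let H ∈ C³(Ω) satisfy H > δ, |H_x| > δ and |H_y| > δ on Ω for some δ > 0, as well as the PDI a² H_xx/H_x² + (1−a²−b²) H_xy/(H_x H_y) + b² H_yy/H_y² ≥ 0 on Ω, where a, b > 0 satisfy a = |1−b| or a = 1+b. Then for any 1 > α > β > 0 with α + β > 1 there exists R₀ = R₀(α, H) such that for all R > R₀, setting p = R^β and q = −b R^β if a = |1−b|, q = b R^β if a = b+1, one has for all Borel measurable f, g : ℝⁿ → ℝ with (f(x), g(y)) ∈ Ω for all x, y: ∫_{ℝⁿ} ( ∫_{ℝⁿ} H(f((x−y)/a), g(y/b))^R dγ_{p,q,x}(y) )^{1/(R−R^α)} dγ_n(x) ≥ H( ∫_{ℝⁿ} f(x √(1 + 1/(a² R^β))) dγ_n(x), ∫_{ℝⁿ} g(x √(1 + 1/(b² R^β))) dγ_n(x) )^{R/(R−R^α)}. -/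

import Mathlib

open MeasureTheory Real Filter

noncomputable section

abbrev Euc (n : ℕ) := EuclideanSpace ℝ (Fin n)

def Hx (H : ℝ × ℝ → ℝ) (z : ℝ × ℝ) : ℝ := fderiv ℝ H z (1, 0)
def Hy (H : ℝ × ℝ → ℝ) (z : ℝ × ℝ) : ℝ := fderiv ℝ H z (0, 1)
def Hxx (H : ℝ × ℝ → ℝ) (z : ℝ × ℝ) : ℝ := fderiv ℝ (Hx H) z (1, 0)
def Hxy (H : ℝ × ℝ → ℝ) (z : ℝ × ℝ) : ℝ := fderiv ℝ (Hx H) z (0, 1)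
def Hyy (H : ℝ × ℝ → ℝ) (z : ℝ × ℝ) : ℝ := fderiv ℝ (Hy H) z (0, 1)

/-- `γ_n`, the standard Gaussian probability measure `(2π)^{−n/2} e^{−|x|²/2} dx` on `ℝⁿ`. -/
def stdGaussian (n : ℕ) : Measure (Euc n) :=
  volume.withDensity fun x =>
    ENNReal.ofReal ((2 * π) ^ (-(n : ℝ) / 2) * Real.exp (-‖x‖ ^ 2 / 2))

/-- The probability measure `dγ_{p,q,x}(y) = (p/(2π))^{n/2} e^{−|py+qx|²/(2p)} dy` on `ℝⁿ`. -/
def gammaPQX (n : ℕ) (p q : ℝ) (x : Euc n) : Measure (Euc n) :=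
  volume.withDensity fun y =>
    ENNReal.ofReal ((p / (2 * π)) ^ ((n : ℝ) / 2) * Real.exp (-‖p • y + q • x‖ ^ 2 / (2 * p)))

open scoped RealInnerProductSpace

section Jensen

variable {E : Type*} [NormedAddCommGroup E] [InnerProductSpace ℝ E] [FiniteDimensional ℝ E]
  [MeasurableSpace E] [BorelSpace E]
  {G : Type*} [NormedAddCommGroup G] [NormedSpace ℝ G]
  [MeasurableSpace G] [BorelSpace G]
  {ι : Type*} [Fintype ι]

/-- `f` takes values in `[l, r]` and is `C^{1,1}` with gradient `f'`, with constant `A`. -/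
structure IsC11 (A l r : ℝ) (f : E → ℝ) (f' : E → E) : Prop where
  measurable : Measurable f
  measurable_grad : Measurable f'
  mem : ∀ u, f u ∈ Set.Icc l r
  grad_le : ∀ u, ‖f' u‖ ≤ A
  lip : ∀ u v, |f (u + v) - f u| ≤ A * ‖v‖
  taylor : ∀ u v, |f (u + v) - f u - ⟪f' u, v⟫| ≤ A * ‖v‖ ^ 2

/-- Second order lower Taylor expansions of `Φ` on `K`, whose quadratic parts become nonnegative
after taking the Hadamard product with `c`. -/
def HasPosTaylor (c : ι → ι → ℝ) (Φ : (ι → ℝ) → ℝ) (K : Set (ι → ℝ)) : Prop :=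
  ∃ C, 0 ≤ C ∧ ∀ m ∈ K, ∃ (ℓ : ι → ℝ) (q : ι → ι → ℝ), (∀ i j, |q i j| ≤ C) ∧
    (∀ ξ : ι → ℝ, 0 ≤ ∑ i, ∑ j, c i j * q i j * (ξ i * ξ j)) ∧
    ∀ ω ∈ K, Φ m + ∑ i, ℓ i * (ω i - m i) + ∑ i, ∑ j, q i j * ((ω i - m i) * (ω j - m j))
      - C * ‖ω - m‖ ^ 3 ≤ Φ ω

omit [MeasurableSpace E] [BorelSpace E] in
lemma sum_mul_inner_nonneg {a : ι → ι → ℝ}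
    (ha : ∀ ξ : ι → ℝ, 0 ≤ ∑ i, ∑ j, a i j * (ξ i * ξ j)) (g : ι → E) :
    0 ≤ ∑ i, ∑ j, a i j * ⟪g i, g j⟫ := by
  let b := stdOrthonormalBasis ℝ E
  have h : ∑ i, ∑ j, a i j * ⟪g i, g j⟫
      = ∑ k, ∑ i, ∑ j, a i j * (⟪g i, b k⟫ * ⟪g j, b k⟫) := by
    simp_rw [← b.sum_inner_mul_inner (g _) (g _), Finset.mul_sum]
    rw [Finset.sum_comm' (t' := Finset.univ) (s' := fun _ => Finset.univ) (by simp)]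
    conv_lhs => enter [2, j]; rw [Finset.sum_comm]
    rw [Finset.sum_comm]
    conv_lhs => enter [2, k]; rw [Finset.sum_comm]
    simp_rw [real_inner_comm (b _)]
  rw [h]
  exact Finset.sum_nonneg fun k _ => ha _

lemma ContinuousOn.measurable_comp_of_mem {X Y : Type*} [MeasurableSpace X] [TopologicalSpace Y]
    [MeasurableSpace Y] [BorelSpace Y] {Φ : Y → ℝ} {K : Set Y} (hΦ : ContinuousOn Φ K)
    {F : X → Y} (hF : Measurable F) (hFK : ∀ x, F x ∈ K) :
    Measurable fun x => Φ (F x) :=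
  (continuousOn_iff_continuous_domRestrict.1 hΦ).measurable.comp
    (hF.subtype_mk (h := hFK))

lemma integrable_comp_of_isCompact {X Y : Type*} [MeasurableSpace X] [TopologicalSpace Y]
    [MeasurableSpace Y] [BorelSpace Y] {μ : Measure X} [IsFiniteMeasure μ] {Φ : Y → ℝ}
    {K : Set Y} (hΦ : ContinuousOn Φ K) (hK : IsCompact K) {F : X → Y} (hF : Measurable F)
    (hFK : ∀ x, F x ∈ K) : Integrable (fun x => Φ (F x)) μ := by
  obtain ⟨C, hC⟩ := hK.exists_bound_of_continuousOn hΦ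
  exact Integrable.of_bound (hΦ.measurable_comp_of_mem hF hFK).aestronglyMeasurable C
    (ae_of_all _ fun x => hC _ (hFK x))

lemma integrable_of_mem_Icc {X : Type*} [MeasurableSpace X] {μ : Measure X} [IsFiniteMeasure μ]
    {F : X → ℝ} (hF : Measurable F) {l r : ℝ} (h : ∀ x, F x ∈ Set.Icc l r) : Integrable F μ :=
  integrable_comp_of_isCompact continuousOn_id isCompact_Icc hF h

lemma integral_mem_Icc {X : Type*} [MeasurableSpace X] {μ : Measure X} [IsProbabilityMeasure μ]
    {F : X → ℝ} (hF : Measurable F) {l r : ℝ} (h : ∀ x, F x ∈ Set.Icc l r) :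
    ∫ x, F x ∂μ ∈ Set.Icc l r :=
  (convex_Icc l r).integral_mem isClosed_Icc (ae_of_all _ h) (integrable_of_mem_Icc hF h)

lemma quad_error_bound {q : ι → ι → ℝ} {C : ℝ} (hC : 0 ≤ C) (hq : ∀ i j, |q i j| ≤ C)
    {d e : ι → ℝ} {s t : ℝ} (hd : ∀ i, |d i| ≤ s) (he : ∀ i, |e i| ≤ s)
    (hde : ∀ i, |d i - e i| ≤ t) :
    ∑ i, ∑ j, q i j * (e i * e j) - C * Fintype.card ι ^ 2 * (2 * (s * t))
      ≤ ∑ i, ∑ j, q i j * (d i * d j) := by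
  have h : ∀ i j, q i j * (e i * e j) - C * (2 * (s * t)) ≤ q i j * (d i * d j) := by
    intro i j
    have h1 : q i j * (e i * e j) - q i j * (d i * d j)
        = - (q i j * (d i * (d j - e j) + e j * (d i - e i))) := by ring
    have hs : 0 ≤ s := (abs_nonneg _).trans (hd i)
    have h2 : |d i * (d j - e j) + e j * (d i - e i)| ≤ 2 * (s * t) := by
      refine (abs_add_le _ _).trans ?_
      rw [abs_mul, abs_mul]
      have := mul_le_mul (hd i) (hde j) (abs_nonneg _) hs
      have := mul_le_mul (he j) (hde i) (abs_nonneg _) hs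
      linarith
    have h3 := mul_le_mul (hq i j) h2 (abs_nonneg _) hC
    rw [← abs_mul] at h3
    have := neg_abs_le (q i j * (d i * (d j - e j) + e j * (d i - e i)))
    linarith
  calc _ = ∑ i, ∑ j, (q i j * (e i * e j) - C * (2 * (s * t))) := by
        simp only [Finset.sum_sub_distrib, Finset.sum_const, Finset.card_univ, nsmul_eq_mul]
        ring
    _ ≤ _ := Finset.sum_le_sum fun i _ => Finset.sum_le_sum fun j _ => h i j

/-- Jensen's inequality up to a third order error, for one small step. -/
lemma jensen_step {ν : Measure G} [IsProbabilityMeasure ν]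
    (hT : Integrable (fun w => (1 + ‖w‖) ^ 3) ν)
    {L : ι → G →L[ℝ] E} {c : ι → ι → ℝ}
    (hmean : ∀ i u, ∫ w, ⟪u, L i w⟫ ∂ν = 0)
    (hcov : ∀ i j u v, ∫ w, ⟪u, L i w⟫ * ⟪v, L j w⟫ ∂ν = c i j * ⟪u, v⟫)
    {l r : ι → ℝ} {Φ : (ι → ℝ) → ℝ} (hΦ : ContinuousOn Φ (Set.Icc l r))
    (hJ : HasPosTaylor c Φ (Set.Icc l r)) {A : ℝ} (hA : 0 ≤ A) :
    ∃ D, 0 ≤ D ∧ ∀ ρ, 0 ≤ ρ → ρ ≤ 1 → ∀ (f : ι → E → ℝ) (f' : ι → E → E),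
      (∀ i, IsC11 A (l i) (r i) (f i) (f' i)) →
      Φ (fun i => ∫ w, f i (ρ • L i w) ∂ν) - D * ρ ^ 3
        ≤ ∫ w, Φ (fun i => f i (ρ • L i w)) ∂ν := by
  obtain ⟨C, hC, hJ⟩ := hJ
  have hT1 : ∀ {F : G → ℝ}, Continuous F → (∃ K, ∀ w, |F w| ≤ K * (1 + ‖w‖) ^ 3) →
      Integrable F ν := by
    rintro F hF ⟨K, hK⟩
    exact (hT.const_mul K).mono' hF.aestronglyMeasurable (ae_of_all _ hK)
  set B := ∑ i, ‖L i‖ with hB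
  have hB0 : 0 ≤ B := Finset.sum_nonneg fun i _ => norm_nonneg _
  have hLB : ∀ i w, ‖L i w‖ ≤ B * ‖w‖ := fun i w => ((L i).le_opNorm w).trans
    (mul_le_mul_of_nonneg_right
      (Finset.single_le_sum (f := fun i => ‖L i‖) (fun i _ => norm_nonneg _) (Finset.mem_univ i))
      (norm_nonneg _))
  have hw1 : ∀ w : G, 1 ≤ 1 + ‖w‖ := fun w => by linarith [norm_nonneg w]
  have hi2 : Integrable (fun w : G => ‖w‖ ^ 2) ν := by
    refine hT1 (by fun_prop) ⟨1, fun w => ?_⟩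
    rw [abs_of_nonneg (by positivity)]
    nlinarith [norm_nonneg w, pow_nonneg (norm_nonneg w) 3]
  set M := ∫ w, ‖w‖ ^ 2 ∂ν with hM
  have hM0 : 0 ≤ M := integral_nonneg fun w => by positivity
  set C1 := A * ((B + 1) ^ 2 * (1 + M)) with hC1
  have hC10 : 0 ≤ C1 := by positivity
  have hCB : A * (B + B ^ 2 * M) ≤ C1 := mul_le_mul_of_nonneg_left (by nlinarith) hA
  have hCB2 : A * (B ^ 2 * (1 + M)) ≤ C1 := mul_le_mul_of_nonneg_left (by nlinarith) hA
  have hCB3 : A * B ≤ C1 := mul_le_mul_of_nonneg_left (by nlinarith) hA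
  set D' := C * Fintype.card ι ^ 2 * (2 * (C1 * C1)) + C * C1 ^ 3 with hD'
  refine ⟨D' * ∫ w, (1 + ‖w‖) ^ 3 ∂ν, mul_nonneg (by positivity)
    (integral_nonneg fun w => by positivity), ?_⟩
  intro ρ hρ0 hρ1 f f' hf
  have hmeas : ∀ i, Measurable fun w => f i (ρ • L i w) := fun i =>
    (hf i).measurable.comp (by fun_prop)
  have hint : ∀ i, Integrable (fun w => f i (ρ • L i w)) ν := fun i =>
    integrable_of_mem_Icc (hmeas i) fun w => (hf i).mem _
  set m : ι → ℝ := fun i => ∫ w, f i (ρ • L i w) ∂ν with hm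
  have hmK : m ∈ Set.Icc l r := by
    have h := fun i => integral_mem_Icc (μ := ν) (hmeas i) fun w => (hf i).mem _
    exact ⟨fun i => (h i).1, fun i => (h i).2⟩
  obtain ⟨ℓ, q, hq, hpos, htay⟩ := hJ m hmK
  set e : G → ι → ℝ := fun w i => ⟪f' i 0, ρ • L i w⟫ with he
  have hnorm : ∀ i w, ‖ρ • L i w‖ ≤ ρ * (B * ‖w‖) := fun i w => by
    rw [norm_smul, Real.norm_of_nonneg hρ0]
    exact mul_le_mul_of_nonneg_left (hLB i w) hρ0
  have hei : ∀ i, Integrable (fun w => e w i) ν := fun i => by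
    refine hT1 (by fun_prop) ⟨A * (ρ * B), fun w => ?_⟩
    refine (abs_real_inner_le_norm _ _).trans
      ((mul_le_mul ((hf i).grad_le 0) (hnorm i w) (norm_nonneg _) hA).trans ?_)
    have : ‖w‖ ≤ (1 + ‖w‖) ^ 3 := by nlinarith [norm_nonneg w, pow_nonneg (norm_nonneg w) 3]
    calc A * (ρ * (B * ‖w‖)) = A * (ρ * B) * ‖w‖ := by ring
      _ ≤ _ := mul_le_mul_of_nonneg_left this (by positivity)
  have hemean : ∀ i, ∫ w, e w i ∂ν = 0 := fun i => by
    simp only [he, real_inner_smul_right, integral_const_mul, hmean, mul_zero]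
  have hR : ∀ i w, |f i (ρ • L i w) - f i 0 - e w i| ≤ A * B ^ 2 * ρ ^ 2 * ‖w‖ ^ 2 := by
    intro i w
    have := (hf i).taylor 0 (ρ • L i w)
    rw [zero_add] at this
    refine this.trans ?_
    calc A * ‖ρ • L i w‖ ^ 2 ≤ A * (ρ * (B * ‖w‖)) ^ 2 := by gcongr; exact hnorm i w
      _ = _ := by ring
  have hm0 : ∀ i, |f i 0 - m i| ≤ A * B ^ 2 * ρ ^ 2 * M := by
    intro i
    have h1 : m i - f i 0 = ∫ w, (f i (ρ • L i w) - f i 0 - e w i) ∂ν := by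
      rw [integral_sub (f := fun w => f i (ρ • L i w) - f i 0) ((hint i).sub (integrable_const _))
        (hei i), hemean, integral_sub (hint i) (integrable_const _)]
      simp [hm]
    rw [abs_sub_comm, h1, ← Real.norm_eq_abs]
    refine (norm_integral_le_of_norm_le (hi2.const_mul (A * B ^ 2 * ρ ^ 2))
      (ae_of_all _ (hR i))).trans ?_
    rw [integral_const_mul]
  have hρ2 : ρ ^ 2 ≤ ρ := by nlinarith
  have hdb : ∀ w i, |f i (ρ • L i w) - m i| ≤ ρ * C1 * (1 + ‖w‖) := by
    intro w i
    have h1 := (hf i).lip 0 (ρ • L i w)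
    rw [zero_add] at h1
    have h2 : A * ‖ρ • L i w‖ ≤ A * (ρ * (B * ‖w‖)) := by gcongr; exact hnorm i w
    have h3 := abs_sub_le (f i (ρ • L i w)) (f i 0) (m i)
    have h4 : A * B ^ 2 * ρ ^ 2 * M ≤ A * B ^ 2 * ρ * M := by gcongr
    have h5 : ρ * (A * (B + B ^ 2 * M)) * (1 + ‖w‖) ≤ ρ * C1 * (1 + ‖w‖) := by
      have := hw1 w
      gcongr
    have h6 : A * (ρ * (B * ‖w‖)) + A * B ^ 2 * ρ * M
        ≤ ρ * (A * (B + B ^ 2 * M)) * (1 + ‖w‖) := by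
      have : 0 ≤ ρ * A * B + ρ * A * B ^ 2 * M * ‖w‖ := by positivity
      linarith
    linarith [hm0 i]
  have heb : ∀ w i, |e w i| ≤ ρ * C1 * (1 + ‖w‖) := by
    intro w i
    refine (abs_real_inner_le_norm _ _).trans
      ((mul_le_mul ((hf i).grad_le 0) (hnorm i w) (norm_nonneg _) hA).trans ?_)
    have h1 : ρ * (A * B) * ‖w‖ ≤ ρ * C1 * (1 + ‖w‖) := by
      gcongr
      linarith
    linarith
  have hdeb : ∀ w i, |(f i (ρ • L i w) - m i) - e w i| ≤ ρ ^ 2 * C1 * (1 + ‖w‖) ^ 2 := by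
    intro w i
    have h1 : (f i (ρ • L i w) - m i) - e w i
        = (f i (ρ • L i w) - f i 0 - e w i) + (f i 0 - m i) := by ring
    rw [h1]
    refine (abs_add_le _ _).trans ((add_le_add (hR i w) (hm0 i)).trans ?_)
    have h2 : ρ ^ 2 * (A * (B ^ 2 * (1 + M))) * (1 + ‖w‖) ^ 2
        ≤ ρ ^ 2 * C1 * (1 + ‖w‖) ^ 2 := by gcongr
    have h3 : A * B ^ 2 * ρ ^ 2 * ‖w‖ ^ 2 + A * B ^ 2 * ρ ^ 2 * M
        ≤ ρ ^ 2 * (A * (B ^ 2 * (1 + M))) * (1 + ‖w‖) ^ 2 := by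
      have h4 : ‖w‖ ^ 2 + M ≤ (1 + M) * (1 + ‖w‖) ^ 2 := by
        nlinarith [norm_nonneg w, mul_nonneg hM0 (norm_nonneg w),
          mul_nonneg hM0 (sq_nonneg ‖w‖)]
      have h5 := mul_le_mul_of_nonneg_left h4 (show 0 ≤ A * B ^ 2 * ρ ^ 2 by positivity)
      linarith
    linarith
  have hpt : ∀ w, Φ m + ∑ i, ℓ i * (f i (ρ • L i w) - m i) + ∑ i, ∑ j, q i j * (e w i * e w j)
      - D' * ρ ^ 3 * (1 + ‖w‖) ^ 3 ≤ Φ (fun i => f i (ρ • L i w)) := by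
    intro w
    have h1 := htay (fun i => f i (ρ • L i w))
      ⟨fun i => ((hf i).mem _).1, fun i => ((hf i).mem _).2⟩
    have h2 := quad_error_bound hC hq (hdb w) (heb w) (hdeb w)
    have h3 : ‖(fun i => f i (ρ • L i w)) - m‖ ≤ ρ * C1 * (1 + ‖w‖) :=
      (pi_norm_le_iff_of_nonneg (by positivity)).2 fun i => hdb w i
    have h4 : C * ‖(fun i => f i (ρ • L i w)) - m‖ ^ 3 ≤ C * (ρ * C1 * (1 + ‖w‖)) ^ 3 := by
      gcongr
    have h5 : D' * ρ ^ 3 * (1 + ‖w‖) ^ 3 = C * Fintype.card ι ^ 2 *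
        (2 * (ρ * C1 * (1 + ‖w‖) * (ρ ^ 2 * C1 * (1 + ‖w‖) ^ 2)))
        + C * (ρ * C1 * (1 + ‖w‖)) ^ 3 := by
      rw [hD']; ring
    linarith
  have hii : ∀ i, Integrable (fun w => ℓ i * (f i (ρ • L i w) - m i)) ν := fun i =>
    ((hint i).sub (integrable_const _)).const_mul _
  have hij : ∀ i j, Integrable (fun w => q i j * (e w i * e w j)) ν := fun i j => by
    refine (hT1 (by fun_prop) ⟨(ρ * C1) ^ 2, fun w => ?_⟩).const_mul _
    rw [abs_mul]
    refine (mul_le_mul (heb w i) (heb w j) (abs_nonneg _) (by positivity)).trans ?_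
    have : (1 + ‖w‖) ^ 2 ≤ (1 + ‖w‖) ^ 3 := pow_le_pow_right₀ (hw1 w) (by norm_num)
    calc _ = (ρ * C1) ^ 2 * (1 + ‖w‖) ^ 2 := by ring
      _ ≤ _ := mul_le_mul_of_nonneg_left this (by positivity)
  have hs1 := integrable_finsetSum Finset.univ fun i _ => hii i
  have hs2 := integrable_finsetSum Finset.univ fun i _ =>
    integrable_finsetSum Finset.univ fun j _ => hij i j
  have hint_lhs := integral_mono
    ((((integrable_const (Φ m)).add hs1).add hs2).sub (hT.const_mul (D' * ρ ^ 3)))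
    (integrable_comp_of_isCompact (μ := ν) hΦ isCompact_Icc (measurable_pi_lambda _ hmeas)
      fun w => ⟨fun i => ((hf i).mem _).1, fun i => ((hf i).mem _).2⟩) hpt
  refine le_trans ?_ hint_lhs
  rw [integral_sub' (((integrable_const (Φ m)).add hs1).add hs2) (hT.const_mul (D' * ρ ^ 3)),
    integral_add' ((integrable_const (Φ m)).add hs1) hs2,
    integral_add' (integrable_const (Φ m)) hs1,
    integral_finsetSum _ fun i _ => hii i,
    integral_finsetSum _ fun i _ => integrable_finsetSum Finset.univ fun j _ => hij i j,
    integral_const_mul]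
  have hz : ∀ i, ∫ w, ℓ i * (f i (ρ • L i w) - m i) ∂ν = 0 := fun i => by
    rw [integral_const_mul, integral_sub (hint i) (integrable_const _)]
    simp [hm]
  have hqq : ∑ i, ∫ w, ∑ j, q i j * (e w i * e w j) ∂ν
      = ρ ^ 2 * ∑ i, ∑ j, c i j * q i j * ⟪f' i 0, f' j 0⟫ := by
    rw [Finset.mul_sum]
    refine Finset.sum_congr rfl fun i _ => ?_
    rw [integral_finsetSum _ fun j _ => hij i j, Finset.mul_sum]
    refine Finset.sum_congr rfl fun j _ => ?_
    have : ∀ w, e w i * e w j = ρ ^ 2 * (⟪f' i 0, L i w⟫ * ⟪f' j 0, L j w⟫) := fun w => by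
      simp only [he, real_inner_smul_right]; ring
    simp only [this, integral_const_mul, hcov]
    ring
  have := mul_nonneg (sq_nonneg ρ) (sum_mul_inner_nonneg hpos fun i => f' i 0)
  rw [hqq, Finset.sum_congr rfl fun i _ => hz i]
  simp only [integral_const, probReal_univ, smul_eq_mul, one_mul, Finset.sum_const_zero]
  linarith

omit [FiniteDimensional ℝ E] in
lemma IsC11.shift {A l r : ℝ} {f : E → ℝ} {f' : E → E} (hf : IsC11 A l r f f') (a : E) :
    IsC11 A l r (fun u => f (a + u)) (fun u => f' (a + u)) where
  measurable := hf.measurable.comp (measurable_const_add a)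
  measurable_grad := hf.measurable_grad.comp (measurable_const_add a)
  mem u := hf.mem _
  grad_le u := hf.grad_le _
  lip u v := by simpa only [add_assoc] using hf.lip (a + u) v
  taylor u v := by simpa only [add_assoc] using hf.taylor (a + u) v

lemma IsC11.average {X : Type*} [MeasurableSpace X] {μ : Measure X} [IsProbabilityMeasure μ]
    {A l r : ℝ} {f : E → ℝ} {f' : E → E} (hf : IsC11 A l r f f') {T : X → E}
    (hT : Measurable T) :
    IsC11 A l r (fun u => ∫ w, f (u + T w) ∂μ) (fun u => ∫ w, f' (u + T w) ∂μ) := by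
  have hm : ∀ u, Measurable fun w => f (u + T w) := fun u =>
    hf.measurable.comp (hT.const_add u)
  have hi : ∀ u, Integrable (fun w => f (u + T w)) μ := fun u =>
    integrable_of_mem_Icc (hm u) fun w => hf.mem _
  have hm' : ∀ u, Measurable fun w => f' (u + T w) := fun u =>
    hf.measurable_grad.comp (hT.const_add u)
  have hi' : ∀ u, Integrable (fun w => f' (u + T w)) μ := fun u =>
    Integrable.of_bound (hm' u).aestronglyMeasurable A (ae_of_all _ fun w => hf.grad_le _)
  have hadd : Measurable fun z : E × X => z.1 + T z.2 :=
    measurable_fst.add (hT.comp measurable_snd)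
  refine ⟨?_, ?_, fun u => integral_mem_Icc (hm u) fun w => hf.mem _, fun u => ?_,
    fun u v => ?_, fun u v => ?_⟩
  · exact ((hf.measurable.comp hadd).stronglyMeasurable.integral_prod_right').measurable
  · exact ((hf.measurable_grad.comp hadd).stronglyMeasurable.integral_prod_right').measurable
  · simpa using norm_integral_le_of_norm_le_const (μ := μ)
      (ae_of_all _ fun w => hf.grad_le (u + T w))
  · rw [← integral_sub (hi _) (hi _), ← Real.norm_eq_abs]
    have h := norm_integral_le_of_norm_le_const (μ := μ)
      (f := fun w => f (u + v + T w) - f (u + T w)) (C := A * ‖v‖)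
      (ae_of_all _ fun w => by rw [add_right_comm]; exact hf.lip (u + T w) v)
    rwa [probReal_univ, mul_one] at h
  · have h1 : ⟪∫ w, f' (u + T w) ∂μ, v⟫ = ∫ w, ⟪f' (u + T w), v⟫ ∂μ := by
      rw [real_inner_comm, ← integral_inner (hi' u)]
      simp_rw [real_inner_comm]
    rw [h1, ← integral_sub (hi _) (hi _),
      ← integral_sub (f := fun w => f (u + v + T w) - f (u + T w))
      ((hi _).sub (hi _)) ((hi' u).inner_const v), ← Real.norm_eq_abs]
    have h := norm_integral_le_of_norm_le_const (μ := μ)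
      (f := fun w => f (u + v + T w) - f (u + T w) - ⟪f' (u + T w), v⟫) (C := A * ‖v‖ ^ 2)
      (ae_of_all _ fun w => by rw [add_right_comm]; exact hf.taylor (u + T w) v)
    rwa [probReal_univ, mul_one] at h

variable [SecondCountableTopology G]

omit [Fintype ι] in
lemma integral_sqrt_succ_smul {ν : Measure G} [IsProbabilityMeasure ν] {k : ℕ}
    (hstab : (ν.prod ν).map (fun z => √(k : ℝ) • z.1 + z.2)
      = ν.map (fun w => √((k + 1 : ℕ) : ℝ) • w))
    {F : G → ℝ} (hF : Measurable F) {C : ℝ} (hC : ∀ w, ‖F w‖ ≤ C) :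
    ∫ w, F (√((k + 1 : ℕ) : ℝ) • w) ∂ν = ∫ w, ∫ w', F (√(k : ℝ) • w + w') ∂ν ∂ν := by
  rw [← integral_map (φ := fun w => √((k + 1 : ℕ) : ℝ) • w) (by fun_prop)
    hF.aestronglyMeasurable, ← hstab, integral_map (by fun_prop) hF.aestronglyMeasurable,
    integral_prod]
  exact Integrable.of_bound (hF.comp (by fun_prop)).aestronglyMeasurable C
    (ae_of_all _ fun z => hC _)

/-- Iterating a one-step Jensen inequality along a stable law. -/
lemma jensen_iterate {ν : Measure G} [IsProbabilityMeasure ν]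
    (hstab : ∀ k : ℕ, (ν.prod ν).map (fun z => √(k : ℝ) • z.1 + z.2)
      = ν.map (fun w => √((k + 1 : ℕ) : ℝ) • w))
    {L : ι → G →L[ℝ] E} {l r : ι → ℝ} {Φ : (ι → ℝ) → ℝ} (hΦ : ContinuousOn Φ (Set.Icc l r))
    {A ρ ε : ℝ}
    (hstep : ∀ (f : ι → E → ℝ) (f' : ι → E → E), (∀ i, IsC11 A (l i) (r i) (f i) (f' i)) →
      Φ (fun i => ∫ w, f i (ρ • L i w) ∂ν) - ε ≤ ∫ w, Φ (fun i => f i (ρ • L i w)) ∂ν)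
    (k : ℕ) (f : ι → E → ℝ) (f' : ι → E → E) (hf : ∀ i, IsC11 A (l i) (r i) (f i) (f' i)) :
    Φ (fun i => ∫ w, f i (ρ • L i (√(k : ℝ) • w)) ∂ν) - k * ε
      ≤ ∫ w, Φ (fun i => f i (ρ • L i (√(k : ℝ) • w))) ∂ν := by
  induction k generalizing f f' with
  | zero => simp
  | succ k ih =>
    have hmeas : ∀ i, Measurable fun w => f i (ρ • L i w) := fun i =>
      (hf i).measurable.comp (by fun_prop)
    have hmem : ∀ w, (fun i => f i (ρ • L i w)) ∈ Set.Icc l r := fun w =>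
      ⟨fun i => ((hf i).mem _).1, fun i => ((hf i).mem _).2⟩
    obtain ⟨C, hC⟩ := isCompact_Icc.exists_bound_of_continuousOn hΦ
    have hfav : ∀ i, IsC11 A (l i) (r i) (fun u => ∫ w', f i (u + ρ • L i w') ∂ν)
        (fun u => ∫ w', f' i (u + ρ • L i w') ∂ν) := fun i => (hf i).average (by fun_prop)
    have hav : ∀ i, ∫ w, f i (ρ • L i (√((k + 1 : ℕ) : ℝ) • w)) ∂ν
        = ∫ w, ∫ w', f i (ρ • L i (√(k : ℝ) • w) + ρ • L i w') ∂ν ∂ν := by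
      intro i
      obtain ⟨K, hK⟩ := isCompact_Icc.exists_bound_of_continuousOn
        (continuousOn_id (s := Set.Icc (l i) (r i)))
      rw [integral_sqrt_succ_smul (F := fun w => f i (ρ • L i w)) (hstab k) (hmeas i)
        fun w => hK _ ((hf i).mem _)]
      simp only [map_add, smul_add]
    have hmeasΦ := hΦ.measurable_comp_of_mem (measurable_pi_lambda _ hmeas) hmem
    have hΦav : ∫ w, Φ (fun i => f i (ρ • L i (√((k + 1 : ℕ) : ℝ) • w))) ∂ν
        = ∫ w, ∫ w', Φ (fun i => f i (ρ • L i (√(k : ℝ) • w) + ρ • L i w')) ∂ν ∂ν := by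
      rw [integral_sqrt_succ_smul (F := fun w => Φ (fun i => f i (ρ • L i w))) (hstab k)
        hmeasΦ fun w => hC _ (hmem w)]
      simp only [map_add, smul_add]
    simp only [hav]
    rw [hΦav]
    have h1 := ih _ _ hfav
    have hleft : Integrable (fun w => Φ (fun i =>
        ∫ w', f i (ρ • L i (√(k : ℝ) • w) + ρ • L i w') ∂ν)) ν :=
      integrable_comp_of_isCompact hΦ isCompact_Icc
        (measurable_pi_lambda _ fun i => (hfav i).measurable.comp (by fun_prop))
        fun w => ⟨fun i => ((hfav i).mem _).1, fun i => ((hfav i).mem _).2⟩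
    have hright : Integrable (fun w =>
        ∫ w', Φ (fun i => f i (ρ • L i (√(k : ℝ) • w) + ρ • L i w')) ∂ν) ν := by
      refine Integrable.integral_prod_left (μ := ν) (ν := ν) (f := fun z : G × G =>
        Φ (fun i => f i (ρ • L i (√(k : ℝ) • z.1) + ρ • L i z.2))) ?_
      exact integrable_comp_of_isCompact hΦ isCompact_Icc
        (measurable_pi_lambda _ fun i => (hf i).measurable.comp (by fun_prop))
        fun w => ⟨fun i => ((hf i).mem _).1, fun i => ((hf i).mem _).2⟩
    have h2 := integral_mono (hleft.sub (integrable_const ε)) hright fun w =>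
      hstep _ _ fun i => (hf i).shift (ρ • L i (√(k : ℝ) • w))
    rw [integral_sub' hleft (integrable_const ε)] at h2
    simp only [integral_const, probReal_univ, smul_eq_mul, one_mul] at h2
    push_cast
    linarith

/-- Jensen's inequality for correlated `C^{1,1}` functions. -/
lemma jensen_of_isC11 {ν : Measure G} [IsProbabilityMeasure ν]
    (hT : Integrable (fun w => (1 + ‖w‖) ^ 3) ν)
    (hstab : ∀ k : ℕ, (ν.prod ν).map (fun z => √(k : ℝ) • z.1 + z.2)
      = ν.map (fun w => √((k + 1 : ℕ) : ℝ) • w))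
    {L : ι → G →L[ℝ] E} {c : ι → ι → ℝ}
    (hmean : ∀ i u, ∫ w, ⟪u, L i w⟫ ∂ν = 0)
    (hcov : ∀ i j u v, ∫ w, ⟪u, L i w⟫ * ⟪v, L j w⟫ ∂ν = c i j * ⟪u, v⟫)
    {l r : ι → ℝ} {Φ : (ι → ℝ) → ℝ} (hΦ : ContinuousOn Φ (Set.Icc l r))
    (hJ : HasPosTaylor c Φ (Set.Icc l r)) {A : ℝ} (hA : 0 ≤ A)
    {f : ι → E → ℝ} {f' : ι → E → E} (hf : ∀ i, IsC11 A (l i) (r i) (f i) (f' i)) :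
    Φ (fun i => ∫ w, f i (L i w) ∂ν) ≤ ∫ w, Φ (fun i => f i (L i w)) ∂ν := by
  obtain ⟨D, hD, h⟩ := jensen_step hT hmean hcov hΦ hJ hA
  have key : ∀ N : ℕ, Φ (fun i => ∫ w, f i (L i w) ∂ν) - D * (√((N + 1 : ℕ) : ℝ))⁻¹
      ≤ ∫ w, Φ (fun i => f i (L i w)) ∂ν := by
    intro N
    have hs : 1 ≤ √((N + 1 : ℕ) : ℝ) := by
      rw [Real.one_le_sqrt]; push_cast; linarith [N.cast_nonneg (α := ℝ)]
    have hs0 : √((N + 1 : ℕ) : ℝ) ≠ 0 := by positivity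
    have h1 := jensen_iterate hstab hΦ (h (√((N + 1 : ℕ) : ℝ))⁻¹ (by positivity)
      (inv_le_one_of_one_le₀ hs)) (N + 1) f f' hf
    have h2 : ∀ i w, (√((N + 1 : ℕ) : ℝ))⁻¹ • L i (√((N + 1 : ℕ) : ℝ) • w) = L i w := by
      intro i w
      rw [map_smul, inv_smul_smul₀ hs0]
    simp only [h2] at h1
    have h3 : ((N + 1 : ℕ) : ℝ) * (D * (√((N + 1 : ℕ) : ℝ))⁻¹ ^ 3)
        = D * (√((N + 1 : ℕ) : ℝ))⁻¹ := by
      nth_rw 1 [← Real.sq_sqrt (Nat.cast_nonneg (N + 1) : (0 : ℝ) ≤ ((N + 1 : ℕ) : ℝ))]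
      field_simp
    rwa [h3] at h1
  have hlim : Tendsto (fun N : ℕ => Φ (fun i => ∫ w, f i (L i w) ∂ν)
      - D * (√((N + 1 : ℕ) : ℝ))⁻¹) atTop (nhds (Φ (fun i => ∫ w, f i (L i w) ∂ν) - D * 0)) := by
    refine tendsto_const_nhds.sub (Tendsto.const_mul _ (tendsto_inv_atTop_zero.comp ?_))
    exact Real.tendsto_sqrt_atTop.comp
      (tendsto_natCast_atTop_atTop.comp (tendsto_add_atTop_nat 1))
  have := le_of_tendsto' hlim key
  simpa using this

open scoped Convolution

omit [FiniteDimensional ℝ E] [MeasurableSpace E] [BorelSpace E] in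
lemma norm_taylor_le_of_fderiv_lipschitz {F : E → ℝ} {F' : E → E →L[ℝ] ℝ} {A : ℝ}
    (hF : ∀ x, HasFDerivAt F (F' x) x) (hA : ∀ x y, ‖F' y - F' x‖ ≤ A * ‖y - x‖) (u v : E) :
    |F (u + v) - F u - F' u v| ≤ A * ‖v‖ ^ 2 := by
  have hv : u + v ∈ Metric.closedBall u ‖v‖ := by simp
  have h := (convex_closedBall u ‖v‖).norm_image_sub_le_of_norm_hasFDerivWithin_le'
    (f := F) (f' := F') (φ := F' u) (C := A * ‖v‖)
    (fun x _ => (hF x).hasFDerivWithinAt) (fun x hx => ?_) (x := u) (y := u + v)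
    (Metric.mem_closedBall_self (norm_nonneg _)) hv
  · simpa [mul_assoc, sq] using h
  · have h1 := hA u x
    rw [Metric.mem_closedBall, dist_eq_norm] at hx
    rcases le_or_gt 0 A with h0 | h0
    · exact h1.trans (mul_le_mul_of_nonneg_left hx h0)
    · have h2 : A * ‖x - u‖ ≤ 0 := mul_nonpos_of_nonpos_of_nonneg h0.le (norm_nonneg _)
      have h3 : ‖x - u‖ = 0 := by
        have := (norm_nonneg _).trans h1
        have h4 : A * ‖x - u‖ = 0 := le_antisymm h2 this
        exact (mul_eq_zero.1 h4).resolve_left h0.ne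
      have h5 : ‖u + v - u‖ = 0 := by
        have h6 := hA u (u + v)
        have h7 := (norm_nonneg _).trans h6
        have h8 : A * ‖u + v - u‖ = 0 :=
          le_antisymm (mul_nonpos_of_nonpos_of_nonneg h0.le (norm_nonneg _)) h7
        exact (mul_eq_zero.1 h8).resolve_left h0.ne
      simp only [add_sub_cancel_left] at h5
      rw [h5, mul_zero]
      simpa [h3] using h1

lemma exists_norm_convolution_le {V W : Type*} [NormedAddCommGroup V] [NormedSpace ℝ V]
    [NormedAddCommGroup W] [NormedSpace ℝ W] (B : V →L[ℝ] ℝ →L[ℝ] W) {k : E → V}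
    (hk : Continuous k) (hkc : HasCompactSupport k) {f : E → ℝ} {C : ℝ} (hC : ∀ x, ‖f x‖ ≤ C) :
    ∃ A, ∀ x, ‖(k ⋆[B, volume] f) x‖ ≤ A := by
  refine ⟨‖B‖ * C * ∫ t, ‖k t‖, fun x => ?_⟩
  rw [convolution_def, ← integral_const_mul]
  refine norm_integral_le_of_norm_le ((hk.integrable_of_hasCompactSupport hkc).norm.const_mul _)
    (ae_of_all _ fun t => ?_)
  calc ‖B (k t) (f (x - t))‖ ≤ ‖B‖ * ‖k t‖ * ‖f (x - t)‖ := B.le_opNorm₂ _ _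
    _ ≤ ‖B‖ * ‖k t‖ * C := by gcongr; exact hC _
    _ = ‖B‖ * C * ‖k t‖ := by ring

lemma exists_hasFDerivAt_convolution_bounded {V W : Type*} [NormedAddCommGroup V]
    [NormedSpace ℝ V] [NormedAddCommGroup W] [NormedSpace ℝ W] (B : V →L[ℝ] ℝ →L[ℝ] W)
    {k : E → V} (hk : ContDiff ℝ 1 k) (hkc : HasCompactSupport k) {f : E → ℝ}
    (hf : Measurable f) {C : ℝ} (hC : ∀ x, ‖f x‖ ≤ C) :
    ∃ (D : E → E →L[ℝ] W) (A : ℝ), (∀ x, HasFDerivAt (k ⋆[B, volume] f) (D x) x) ∧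
      ∀ x, ‖D x‖ ≤ A := by
  have hfl : LocallyIntegrable f volume :=
    (memLp_top_of_bound hf.aestronglyMeasurable C (ae_of_all _ hC)).locallyIntegrable le_top
  obtain ⟨A, hA⟩ := exists_norm_convolution_le (B.precompL E)
    (hk.continuous_fderiv (by norm_num)) (hkc.fderiv (𝕜 := ℝ)) hC
  exact ⟨_, A, hkc.hasFDerivAt_convolution_left B hk hfl, hA⟩

lemma exists_isC11_normed_convolution (φ : ContDiffBump (0 : E)) {f : E → ℝ} (hf : Measurable f)
    {l r : ℝ} (hfm : ∀ x, f x ∈ Set.Icc l r) :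
    ∃ A f', IsC11 A l r (φ.normed volume ⋆[ContinuousLinearMap.lsmul ℝ ℝ, volume] f) f' := by
  set k : E → ℝ := φ.normed volume with hk
  set B := ContinuousLinearMap.lsmul ℝ ℝ (E := ℝ) with hB
  have hkc : HasCompactSupport k := φ.hasCompactSupport_normed
  have hks : ContDiff ℝ 2 k := φ.contDiff_normed
  obtain ⟨C, hC⟩ := isCompact_Icc.exists_bound_of_continuousOn
    (continuousOn_id (s := Set.Icc l r))
  replace hC : ∀ x, ‖f x‖ ≤ C := fun x => hC _ (hfm x)
  have hfl : LocallyIntegrable f volume :=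
    (memLp_top_of_bound hf.aestronglyMeasurable C (ae_of_all _ hC)).locallyIntegrable le_top
  have hk1 : ContDiff ℝ 1 (fderiv ℝ k) := hks.fderiv_right (m := 1) (by norm_num)
  have hD : ∀ x, HasFDerivAt (k ⋆[B, volume] f)
      ((fderiv ℝ k ⋆[B.precompL E, volume] f) x) x :=
    hkc.hasFDerivAt_convolution_left B (hks.of_le (by norm_num)) hfl
  obtain ⟨D2, A2, hD2, hb2⟩ := exists_hasFDerivAt_convolution_bounded (B.precompL E) hk1
    (hkc.fderiv (𝕜 := ℝ)) hf hC
  obtain ⟨A1, hb1⟩ := exists_norm_convolution_le (B.precompL E) hk1.continuous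
    (hkc.fderiv (𝕜 := ℝ)) hC
  have hlip : ∀ x y, ‖(k ⋆[B, volume] f) y - (k ⋆[B, volume] f) x‖ ≤ A1 * ‖y - x‖ :=
    fun x y => convex_univ.norm_image_sub_le_of_norm_hasFDerivWithin_le
      (fun z _ => (hD z).hasFDerivWithinAt) (fun z _ => hb1 z) (Set.mem_univ _) (Set.mem_univ _)
  have hlip2 : ∀ x y, ‖(fderiv ℝ k ⋆[B.precompL E, volume] f) y
      - (fderiv ℝ k ⋆[B.precompL E, volume] f) x‖ ≤ A2 * ‖y - x‖ :=
    fun x y => convex_univ.norm_image_sub_le_of_norm_hasFDerivWithin_le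
      (fun z _ => (hD2 z).hasFDerivWithinAt) (fun z _ => hb2 z) (Set.mem_univ _) (Set.mem_univ _)
  have hcont : Continuous (k ⋆[B, volume] f) :=
    continuous_iff_continuousAt.2 fun x => (hD x).continuousAt
  have hcont2 : Continuous (fderiv ℝ k ⋆[B.precompL E, volume] f) :=
    continuous_iff_continuousAt.2 fun x => (hD2 x).continuousAt
  refine ⟨max A1 A2, fun x =>
    (InnerProductSpace.toDual ℝ E).symm ((fderiv ℝ k ⋆[B.precompL E, volume] f) x),
    hcont.measurable, ?_, fun u => ?_, fun u => ?_, fun u v => ?_, fun u v => ?_⟩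
  · exact ((InnerProductSpace.toDual ℝ E).symm.continuous.comp hcont2).measurable
  · have hint : Integrable k volume := hks.continuous.integrable_of_hasCompactSupport hkc
    have hint2 : Integrable (fun t => k t * f (u - t)) volume := by
      refine hint.mul_bdd (c := C) (hf.comp (by fun_prop)).aestronglyMeasurable
        (ae_of_all _ fun t => hC _)
    have hone : ∫ t, k t = 1 := φ.integral_normed
    have hk0 : ∀ t, 0 ≤ k t := fun t => φ.nonneg_normed t
    have hval : (k ⋆[B, volume] f) u = ∫ t, k t * f (u - t) := by
      rw [convolution_def]; simp [hB]
    rw [hval]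
    constructor
    · have := integral_mono (hint.mul_const l) hint2 fun t =>
        mul_le_mul_of_nonneg_left (hfm (u - t)).1 (hk0 t)
      rwa [integral_mul_const, hone, one_mul] at this
    · have := integral_mono hint2 (hint.mul_const r) fun t =>
        mul_le_mul_of_nonneg_left (hfm (u - t)).2 (hk0 t)
      rwa [integral_mul_const, hone, one_mul] at this
  · rw [LinearIsometryEquiv.norm_map]
    exact (hb1 u).trans (le_max_left _ _)
  · have := hlip u (u + v)
    rw [add_sub_cancel_left] at this
    exact this.trans (mul_le_mul_of_nonneg_right (le_max_left _ _) (norm_nonneg _))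
  · rw [InnerProductSpace.toDual_symm_apply]
    exact (norm_taylor_le_of_fderiv_lipschitz hD hlip2 u v).trans
      (mul_le_mul_of_nonneg_right (le_max_right _ _) (by positivity))

omit [FiniteDimensional ℝ E] [BorelSpace E] in
lemma IsC11.mono {A A' l r : ℝ} {f : E → ℝ} {f' : E → E} (hf : IsC11 A l r f f') (h : A ≤ A') :
    IsC11 A' l r f f' where
  measurable := hf.measurable
  measurable_grad := hf.measurable_grad
  mem := hf.mem
  grad_le u := (hf.grad_le u).trans h
  lip u v := (hf.lip u v).trans (mul_le_mul_of_nonneg_right h (norm_nonneg _))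
  taylor u v := (hf.taylor u v).trans (mul_le_mul_of_nonneg_right h (by positivity))

omit [FiniteDimensional ℝ E] in
lemma IsC11.shrink {A l r : ℝ} {f : E → ℝ} {f' : E → E} (hf : IsC11 A l r f f') {t : ℝ}
    (ht0 : 0 ≤ t) (ht1 : t ≤ 1) (a : ℝ) :
    IsC11 A (t * l + (1 - t) * a) (t * r + (1 - t) * a) (fun u => t * f u + (1 - t) * a)
      (fun u => t • f' u) := by
  have hscale : ∀ {x y : ℝ}, |x| ≤ y → |t * x| ≤ y := fun {x y} h => by
    rw [abs_mul, abs_of_nonneg ht0]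
    exact (mul_le_of_le_one_left (abs_nonneg _) ht1).trans h
  refine ⟨(hf.measurable.const_mul t).add_const _, hf.measurable_grad.const_smul t, fun u => ?_,
    fun u => ?_, fun u v => ?_, fun u v => ?_⟩
  · have := hf.mem u
    exact ⟨by gcongr; exact this.1, by gcongr; exact this.2⟩
  · rw [norm_smul, Real.norm_of_nonneg ht0]
    exact (mul_le_of_le_one_left (norm_nonneg _) ht1).trans (hf.grad_le u)
  · convert hscale (hf.lip u v) using 2
    ring
  · convert hscale (hf.taylor u v) using 2
    rw [real_inner_smul_left]
    ring

lemma exists_isC11_seq {f : E → ℝ} (hf : Measurable f) {l r : ℝ} (hlr : l < r)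
    (hfm : ∀ x, f x ∈ Set.Icc l r) :
    ∃ (F : ℕ → E → ℝ) (F' : ℕ → E → E) (A l' r' : ℕ → ℝ),
      (∀ j, IsC11 (A j) (l' j) (r' j) (F j) (F' j)) ∧ (∀ j, l < l' j) ∧ (∀ j, r' j < r) ∧
      ∀ᵐ x, Tendsto (fun j => F j x) atTop (nhds (f x)) := by
  have hpos : ∀ j : ℕ, (0 : ℝ) < 1 / ((j : ℝ) + 1) := fun j => by positivity
  let φ : ℕ → ContDiffBump (0 : E) := fun j =>
    ⟨1 / ((j : ℝ) + 1), 2 * (1 / ((j : ℝ) + 1)), hpos j, by linarith [hpos j]⟩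
  choose A g' hg using fun j => exists_isC11_normed_convolution (φ j) hf hfm
  let t : ℕ → ℝ := fun j => 1 - 1 / ((j : ℝ) + 2)
  have ht1 : ∀ j, t j < 1 := fun j => by
    have : (0 : ℝ) < 1 / ((j : ℝ) + 2) := by positivity
    simp only [t]; linarith
  have ht0 : ∀ j, 0 ≤ t j := fun j => by
    have : 1 / ((j : ℝ) + 2) ≤ 1 := by
      rw [div_le_one (by positivity)]; linarith [j.cast_nonneg (α := ℝ)]
    simp only [t]; linarith
  refine ⟨_, _, A, _, _, fun j => (hg j).shrink (ht0 j) (ht1 j).le ((l + r) / 2), fun j => ?_,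
    fun j => ?_, ?_⟩
  · nlinarith [ht1 j]
  · nlinarith [ht1 j]
  · obtain ⟨C, hC⟩ := isCompact_Icc.exists_bound_of_continuousOn
      (continuousOn_id (s := Set.Icc l r))
    have hfl : LocallyIntegrable f volume :=
      (memLp_top_of_bound hf.aestronglyMeasurable C
        (ae_of_all _ fun x => hC _ (hfm x))).locallyIntegrable le_top
    have hlim : Tendsto (fun j : ℕ => 1 / ((j : ℝ) + 1)) atTop (nhds 0) :=
      tendsto_one_div_add_atTop_nhds_zero_nat
    have hae := ContDiffBump.ae_convolution_tendsto_right_of_locallyIntegrable (φ := φ)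
      (l := atTop) (K := 2) (by simpa [φ] using hlim.const_mul 2)
      (Eventually.of_forall fun j => le_rfl) hfl
    have htl : Tendsto t atTop (nhds 1) := by
      have h2 : Tendsto (fun j : ℕ => 1 / ((j : ℝ) + 2)) atTop (nhds 0) := by
        refine ((tendsto_add_atTop_iff_nat 1).2 hlim).congr fun j => ?_
        push_cast; ring_nf
      simpa [t] using tendsto_const_nhds.sub h2
    filter_upwards [hae] with x hx
    have := (htl.mul hx).add ((tendsto_const_nhds (x := (1 : ℝ)).sub htl).mul_const ((l + r) / 2))
    simpa using this

lemma ContinuousOn.tendsto_integral_comp {X Y : Type*} [MeasurableSpace X] [TopologicalSpace Y]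
    [MeasurableSpace Y] [BorelSpace Y] {μ : Measure X} [IsFiniteMeasure μ] {Φ : Y → ℝ}
    {K : Set Y} (hΦ : ContinuousOn Φ K) (hK : IsCompact K) {F : ℕ → X → Y} {F₀ : X → Y}
    (hF : ∀ j, Measurable (F j)) (hFK : ∀ j x, F j x ∈ K) (hF₀K : ∀ x, F₀ x ∈ K)
    (hlim : ∀ᵐ x ∂μ, Tendsto (fun j => F j x) atTop (nhds (F₀ x))) :
    Tendsto (fun j => ∫ x, Φ (F j x) ∂μ) atTop (nhds (∫ x, Φ (F₀ x) ∂μ)) := by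
  obtain ⟨C, hC⟩ := hK.exists_bound_of_continuousOn hΦ
  refine tendsto_integral_of_dominated_convergence (fun _ => C)
    (fun j => (hΦ.measurable_comp_of_mem (hF j) (hFK j)).aestronglyMeasurable)
    (integrable_const C) (fun j => ae_of_all _ fun x => hC _ (hFK j x)) ?_
  filter_upwards [hlim] with x hx
  exact (hΦ _ (hF₀K x)).tendsto.comp
    (tendsto_nhdsWithin_iff.2 ⟨hx, Eventually.of_forall fun j => hFK j x⟩)

/-- Jensen's inequality for functions of several correlated vectors, when the Hadamard product of
the covariance with the Hessian of `Φ` is nonnegative in the interior of a box. -/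
lemma jensen_of_measurable {ν : Measure G} [IsProbabilityMeasure ν]
    (hT : Integrable (fun w => (1 + ‖w‖) ^ 3) ν)
    (hstab : ∀ k : ℕ, (ν.prod ν).map (fun z => √(k : ℝ) • z.1 + z.2)
      = ν.map (fun w => √((k + 1 : ℕ) : ℝ) • w))
    {L : ι → G →L[ℝ] E} {c : ι → ι → ℝ}
    (hmean : ∀ i u, ∫ w, ⟪u, L i w⟫ ∂ν = 0)
    (hcov : ∀ i j u v, ∫ w, ⟪u, L i w⟫ * ⟪v, L j w⟫ ∂ν = c i j * ⟪u, v⟫)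
    (habs : ∀ i, ν.map (L i) ≪ volume)
    {l r : ι → ℝ} (hlr : ∀ i, l i < r i) {Φ : (ι → ℝ) → ℝ} (hΦ : ContinuousOn Φ (Set.Icc l r))
    (hJ : ∀ l' r' : ι → ℝ, (∀ i, l i < l' i) → (∀ i, r' i < r i) →
      HasPosTaylor c Φ (Set.Icc l' r'))
    {f : ι → E → ℝ} (hf : ∀ i, Measurable (f i)) (hfm : ∀ i x, f i x ∈ Set.Icc (l i) (r i)) :
    Φ (fun i => ∫ w, f i (L i w) ∂ν) ≤ ∫ w, Φ (fun i => f i (L i w)) ∂ν := by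
  choose F F' A l' r' hF hl' hr' hlim using fun i => exists_isC11_seq (hf i) (hlr i) (hfm i)
  have hLm : ∀ i, Measurable (L i) := fun i => (L i).continuous.measurable
  have hFm : ∀ i j x, F i j x ∈ Set.Icc (l i) (r i) := fun i j x =>
    ⟨(hl' i j).le.trans ((hF i j).mem x).1, ((hF i j).mem x).2.trans (hr' i j).le⟩
  have hmeas : ∀ i j, Measurable fun w => F i j (L i w) := fun i j =>
    (hF i j).measurable.comp (hLm i)
  have hlim' : ∀ i, ∀ᵐ w ∂ν, Tendsto (fun j => F i j (L i w)) atTop (nhds (f i (L i w))) :=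
    fun i => ae_of_ae_map (hLm i).aemeasurable ((habs i).ae_le (hlim i))
  have hstep : ∀ j, Φ (fun i => ∫ w, F i j (L i w) ∂ν) ≤ ∫ w, Φ (fun i => F i j (L i w)) ∂ν := by
    intro j
    have hA : ∀ i, A i j ≤ ∑ k, |A k j| := fun i => (le_abs_self _).trans
      (Finset.single_le_sum (f := fun k => |A k j|) (fun k _ => abs_nonneg _) (Finset.mem_univ i))
    exact jensen_of_isC11 hT hstab hmean hcov
      (hΦ.mono (Set.Icc_subset_Icc (fun i => (hl' i j).le) fun i => (hr' i j).le))
      (hJ (fun i => l' i j) (fun i => r' i j) (fun i => hl' i j) fun i => hr' i j)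
      (Finset.sum_nonneg fun k _ => abs_nonneg (A k j)) fun i => (hF i j).mono (hA i)
  refine le_of_tendsto_of_tendsto' (b := atTop) ?_ ?_ hstep
  · have hm : ∀ j, (fun i => ∫ w, F i j (L i w) ∂ν) ∈ Set.Icc l r := fun j =>
      ⟨fun i => (integral_mem_Icc (hmeas i j) fun w => hFm i j _).1,
        fun i => (integral_mem_Icc (hmeas i j) fun w => hFm i j _).2⟩
    have hm₀ : (fun i => ∫ w, f i (L i w) ∂ν) ∈ Set.Icc l r :=
      ⟨fun i => (integral_mem_Icc ((hf i).comp (hLm i)) fun w => hfm i _).1,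
        fun i => (integral_mem_Icc ((hf i).comp (hLm i)) fun w => hfm i _).2⟩
    refine (hΦ _ hm₀).tendsto.comp
      (tendsto_nhdsWithin_iff.2 ⟨tendsto_pi_nhds.2 fun i => ?_, Eventually.of_forall hm⟩)
    exact continuousOn_id.tendsto_integral_comp isCompact_Icc (hmeas i) (fun j w => hFm i j _)
      (fun w => hfm i _) (hlim' i)
  · refine hΦ.tendsto_integral_comp isCompact_Icc (F := fun j w i => F i j (L i w))
      (fun j => measurable_pi_lambda _ fun i => hmeas i j)
      (fun j w => ⟨fun i => (hFm i j _).1, fun i => (hFm i j _).2⟩)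
      (fun w => ⟨fun i => (hfm i _).1, fun i => (hfm i _).2⟩) ?_
    filter_upwards [ae_all_iff.2 hlim'] with w hw
    exact tendsto_pi_nhds.2 hw

end Jensen

section Gaussian

variable {E : Type*} [NormedAddCommGroup E] [InnerProductSpace ℝ E] [FiniteDimensional ℝ E]
  [MeasurableSpace E] [BorelSpace E]
  {G : Type*} [NormedAddCommGroup G] [NormedSpace ℝ G]
  [MeasurableSpace G] [BorelSpace G]

open ProbabilityTheory in
lemma stdGaussian_eq (n : ℕ) : _root_.stdGaussian n = ProbabilityTheory.stdGaussian (Euc n) := by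
  have hρ : Measurable fun x : Euc n =>
      (2 * π) ^ (-(n : ℝ) / 2) * Real.exp (-‖x‖ ^ 2 / 2) := by fun_prop
  have hρ0 : ∀ x : Euc n, 0 ≤ (2 * π) ^ (-(n : ℝ) / 2) * Real.exp (-‖x‖ ^ 2 / 2) :=
    fun x => by positivity
  have hint : Integrable fun x : Euc n =>
      (2 * π) ^ (-(n : ℝ) / 2) * Real.exp (-‖x‖ ^ 2 / 2) := by
    have h := (GaussianFourier.integrable_cexp_neg_mul_sq_norm_add (V := Euc n)
      (b := (1 / 2 : ℂ)) (by norm_num) 0 0).norm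
    refine (h.const_mul ((2 * π) ^ (-(n : ℝ) / 2))).congr (ae_of_all _ fun x => ?_)
    simp only [Complex.norm_exp]
    congr 2
    have : (-(1 / 2 : ℂ) * (‖x‖ : ℂ) ^ 2 + 0 * ((inner ℝ (0 : Euc n) x : ℝ) : ℂ))
        = ((-‖x‖ ^ 2 / 2 : ℝ) : ℂ) := by push_cast; ring
    rw [this, Complex.ofReal_re]
  have : IsFiniteMeasure (_root_.stdGaussian n) := by
    refine isFiniteMeasure_withDensity ?_
    exact (hasFiniteIntegral_iff_ofReal (ae_of_all _ hρ0)).1 hint.2 |>.ne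
  refine Measure.ext_of_charFun ?_
  ext t
  rw [charFun_stdGaussian, charFun_apply, _root_.stdGaussian,
    integral_withDensity_eq_integral_toReal_smul (by fun_prop) (ae_of_all _ fun _ => by simp)]
  have h := GaussianFourier.integral_cexp_neg_mul_sq_norm_add (V := Euc n)
    (b := (1 / 2 : ℂ)) (by norm_num) Complex.I t
  have h2 : ∀ x : Euc n,
      (ENNReal.ofReal ((2 * π) ^ (-(n : ℝ) / 2) * Real.exp (-‖x‖ ^ 2 / 2))).toReal
      • Complex.exp ((inner ℝ x t : ℝ) * Complex.I)
      = (((2 * π) ^ (-(n : ℝ) / 2) : ℝ) : ℂ) * Complex.exp (-(1 / 2 : ℂ) * (‖x‖ : ℂ) ^ 2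
        + Complex.I * ((inner ℝ t x : ℝ) : ℂ)) := by
    intro x
    rw [ENNReal.toReal_ofReal (hρ0 x), Complex.exp_add, Complex.real_smul, real_inner_comm]
    push_cast
    rw [mul_assoc, mul_comm Complex.I]
    congr 4
    ring
  simp_rw [h2]
  rw [integral_const_mul, h, finrank_euclideanSpace_fin, ← mul_assoc]
  have h3 : (((2 * π) ^ (-(n : ℝ) / 2) : ℝ) : ℂ) * ((π : ℂ) / (1 / 2)) ^ ((n : ℂ) / 2) = 1 := by
    have : ((π : ℂ) / (1 / 2)) ^ ((n : ℂ) / 2) = (((2 * π) ^ ((n : ℝ) / 2) : ℝ) : ℂ) := by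
      rw [Complex.ofReal_cpow (by positivity)]
      push_cast
      congr 1
      ring
    rw [this, ← Complex.ofReal_mul, ← Real.rpow_add (by positivity)]
    norm_num [neg_div]
  rw [h3, one_mul, Complex.I_sq]
  congr 1
  ring

variable [CompleteSpace G] [SecondCountableTopology G]

open ProbabilityTheory in
/-- A centered Gaussian measure is stable under linear combinations of independent copies. -/
lemma map_smul_add_smul_prod {μ : Measure G} [IsGaussian μ] (hμ : μ[id] = 0) (s t : ℝ) :
    (μ.prod μ).map (fun z => s • z.1 + t • z.2) = μ.map (fun x => √(s ^ 2 + t ^ 2) • x) := by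
  set c : ℂ := ⟨s, t⟩ with hc
  have hr : √(s ^ 2 + t ^ 2) = ‖c‖ := by
    rw [Complex.norm_def, Complex.normSq_mk]; ring_nf
  have hs : s = ‖c‖ * Real.cos c.arg := by rw [Complex.norm_mul_cos_arg]
  have ht : t = ‖c‖ * Real.sin c.arg := by rw [Complex.norm_mul_sin_arg]
  have hrot := IsGaussian.map_rotation_eq_self hμ c.arg
  have h1 : (fun z : G × G => s • z.1 + t • z.2)
      = (fun x => ‖c‖ • x) ∘ Prod.fst ∘ ContinuousLinearMap.rotation c.arg := by
    ext z
    simp only [Function.comp, ContinuousLinearMap.rotation_apply, smul_add, smul_smul, ← hs, ← ht]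
  rw [h1, hr, ← Measure.map_map (by fun_prop) (by fun_prop),
    ← Measure.map_map (by fun_prop) (by fun_prop), hrot, Measure.map_fst_prod]
  simp

open ProbabilityTheory in
lemma map_sqrt_smul_add_prod {μ : Measure G} [IsGaussian μ] (hμ : μ[id] = 0) (k : ℕ) :
    (μ.prod μ).map (fun z => √(k : ℝ) • z.1 + z.2) = μ.map (fun w => √((k + 1 : ℕ) : ℝ) • w) := by
  have := map_smul_add_smul_prod hμ (√(k : ℝ)) 1
  rw [Real.sq_sqrt k.cast_nonneg] at this
  simpa using this

open ProbabilityTheory in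
lemma integrable_one_add_norm_pow_three (μ : Measure G) [IsGaussian μ] :
    Integrable (fun w => (1 + ‖w‖) ^ 3) μ := by
  have h0 : MemLp (id : G → G) (3 : ℕ) μ := IsGaussian.memLp_id μ _ (ENNReal.natCast_ne_top 3)
  have h : MemLp (fun w : G => 1 + ‖w‖) (3 : ℕ) μ :=
    MemLp.add (memLp_const (1 : ℝ)) h0.norm
  refine (h.integrable_norm_pow three_ne_zero).congr (ae_of_all _ fun w => ?_)
  exact congrArg (· ^ 3) (Real.norm_of_nonneg (add_nonneg zero_le_one (norm_nonneg w)))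

open ProbabilityTheory in
lemma integral_inner_mul_inner_stdGaussian (u v : E) :
    ∫ x, ⟪u, x⟫ * ⟪v, x⟫ ∂(ProbabilityTheory.stdGaussian E) = ⟪u, v⟫ := by
  have h := covarianceBilin_apply (μ := ProbabilityTheory.stdGaussian E)
    IsGaussian.memLp_two_id u v
  simpa [covarianceBilin_stdGaussian, innerSL_apply_apply ℝ] using h.symm

open ProbabilityTheory in
lemma integral_inner_stdGaussian (u : E) :
    ∫ x, ⟪u, x⟫ ∂(ProbabilityTheory.stdGaussian E) = 0 := by
  simpa using integral_strongDual_stdGaussian (innerSL ℝ u)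

/-- The continuous linear map `(x, z) ↦ α x + β z`. -/
def combo (E : Type*) [NormedAddCommGroup E] [NormedSpace ℝ E] (α β : ℝ) : E × E →L[ℝ] E :=
  α • ContinuousLinearMap.fst ℝ E E + β • ContinuousLinearMap.snd ℝ E E

omit [FiniteDimensional ℝ E] [MeasurableSpace E] [BorelSpace E] in
@[simp]
lemma combo_apply (α β : ℝ) (z : E × E) : combo E α β z = α • z.1 + β • z.2 := rfl

open ProbabilityTheory in
lemma integral_inner_combo (α β : ℝ) (u : E) :
    ∫ w, ⟪u, combo E α β w⟫
      ∂((ProbabilityTheory.stdGaussian E).prod (ProbabilityTheory.stdGaussian E)) = 0 := by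
  have hi : Integrable (fun x => ⟪u, x⟫) (ProbabilityTheory.stdGaussian E) :=
    IsGaussian.integrable_dual _ (innerSL ℝ u)
  simp only [combo_apply, inner_add_right, real_inner_smul_right]
  rw [integral_add ((hi.comp_fst _).const_mul α) ((hi.comp_snd _).const_mul β),
    integral_const_mul, integral_const_mul, integral_fun_fst (f := fun x => ⟪u, x⟫),
    integral_fun_snd (f := fun x => ⟪u, x⟫)]
  simp [integral_inner_stdGaussian]

open ProbabilityTheory in
lemma integral_inner_combo_mul_inner_combo (α β α' β' : ℝ) (u v : E) :
    ∫ w, ⟪u, combo E α β w⟫ * ⟪v, combo E α' β' w⟫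
      ∂((ProbabilityTheory.stdGaussian E).prod (ProbabilityTheory.stdGaussian E))
      = (α * α' + β * β') * ⟪u, v⟫ := by
  set γ := ProbabilityTheory.stdGaussian E with hγ
  have hi : ∀ u : E, Integrable (fun x => ⟪u, x⟫) γ := fun u =>
    IsGaussian.integrable_dual _ (innerSL ℝ u)
  have hi2 : ∀ u v : E, Integrable (fun x => ⟪u, x⟫ * ⟪v, x⟫) γ := fun u v =>
    (IsGaussian.memLp_dual γ (innerSL ℝ u) 2 (by simp)).integrable_mul
      (IsGaussian.memLp_dual γ (innerSL ℝ v) 2 (by simp))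
  have e : ∀ w : E × E, ⟪u, combo E α β w⟫ * ⟪v, combo E α' β' w⟫
      = ((α * α') * (⟪u, w.1⟫ * ⟪v, w.1⟫) + (β * β') * (⟪u, w.2⟫ * ⟪v, w.2⟫))
        + ((α * β') * (⟪u, w.1⟫ * ⟪v, w.2⟫) + (β * α') * (⟪v, w.1⟫ * ⟪u, w.2⟫)) := by
    intro w
    simp only [combo_apply, inner_add_right, real_inner_smul_right]
    ring
  simp_rw [e]
  have h1 := ((hi2 u v).comp_fst γ).const_mul (α * α')
  have h2 := ((hi2 u v).comp_snd γ).const_mul (β * β')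
  have h3 := ((hi u).mul_prod (hi v)).const_mul (α * β')
  have h4 := ((hi v).mul_prod (hi u)).const_mul (β * α')
  rw [integral_add (h1.fun_add h2) (h3.fun_add h4), integral_add h1 h2, integral_add h3 h4]
  simp only [integral_const_mul]
  rw [integral_prod_mul (fun x => ⟪u, x⟫) (fun x => ⟪v, x⟫),
    integral_prod_mul (fun x => ⟪v, x⟫) (fun x => ⟪u, x⟫),
    integral_fun_fst (f := fun x => ⟪u, x⟫ * ⟪v, x⟫),
    integral_fun_snd (f := fun x => ⟪u, x⟫ * ⟪v, x⟫)]
  simp only [hγ, integral_inner_stdGaussian, integral_inner_mul_inner_stdGaussian]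
  simp
  ring

open ProbabilityTheory in
lemma map_combo_stdGaussian (α β : ℝ) :
    ((ProbabilityTheory.stdGaussian E).prod (ProbabilityTheory.stdGaussian E)).map (combo E α β)
      = (ProbabilityTheory.stdGaussian E).map (fun x => √(α ^ 2 + β ^ 2) • x) := by
  have := FiniteDimensional.complete ℝ E
  exact map_smul_add_smul_prod (by simp) α β

lemma stdGaussian_absolutelyContinuous (n : ℕ) :
    ProbabilityTheory.stdGaussian (Euc n) ≪ volume := by
  rw [← stdGaussian_eq]
  exact withDensity_absolutelyContinuous _ _

lemma map_combo_absolutelyContinuous (n : ℕ) {α β : ℝ} (h : 0 < α ^ 2 + β ^ 2) :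
    ((ProbabilityTheory.stdGaussian (Euc n)).prod
      (ProbabilityTheory.stdGaussian (Euc n))).map (combo (Euc n) α β) ≪ volume := by
  rw [map_combo_stdGaussian]
  refine ((stdGaussian_absolutelyContinuous n).map (by fun_prop)).trans ?_
  rw [Measure.map_addHaar_smul _ (Real.sqrt_pos.2 h).ne']
  exact Measure.smul_absolutelyContinuous

lemma integral_comp_combo {n : ℕ} (α β : ℝ) {F : Euc n → ℝ} (hF : Measurable F) :
    ∫ w, F (combo (Euc n) α β w) ∂((ProbabilityTheory.stdGaussian (Euc n)).prod
      (ProbabilityTheory.stdGaussian (Euc n)))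
      = ∫ x, F (√(α ^ 2 + β ^ 2) • x) ∂(ProbabilityTheory.stdGaussian (Euc n)) := by
  rw [← integral_map (φ := combo (Euc n) α β) (by fun_prop) hF.aestronglyMeasurable,
    map_combo_stdGaussian, integral_map (by fun_prop) hF.aestronglyMeasurable]

/-- Under `γ_{p,q,x}`, a vector is distributed as `-(q/p) x + p^{-1/2} z` with `z` standard. -/
lemma integral_gammaPQX {n : ℕ} {p : ℝ} (hp : 0 < p) (q : ℝ) (x : Euc n) (F : Euc n → ℝ) :
    ∫ y, F y ∂(gammaPQX n p q x)
      = ∫ z, F (-(q / p) • x + (√p)⁻¹ • z) ∂(ProbabilityTheory.stdGaussian (Euc n)) := by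
  have hsp : 0 < √p := Real.sqrt_pos.2 hp
  rw [← stdGaussian_eq, _root_.stdGaussian, gammaPQX,
    integral_withDensity_eq_integral_toReal_smul (by fun_prop) (ae_of_all _ fun _ => by simp),
    integral_withDensity_eq_integral_toReal_smul (by fun_prop) (ae_of_all _ fun _ => by simp)]
  simp_rw [ENNReal.toReal_ofReal (mul_nonneg (Real.rpow_nonneg (by positivity : 0 ≤ p / (2 * π)) _)
    (Real.exp_nonneg _)), ENNReal.toReal_ofReal (mul_nonneg (Real.rpow_nonneg
    (by positivity : 0 ≤ 2 * π) _) (Real.exp_nonneg _)), smul_eq_mul]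
  set J : Euc n → ℝ := fun y => (p / (2 * π)) ^ ((n : ℝ) / 2)
    * Real.exp (-‖p • y + q • x‖ ^ 2 / (2 * p)) * F y with hJ
  have h1 : ∫ y, J y = ∫ y, J (-(q / p) • x + y) := (integral_add_left_eq_self J _).symm
  have h2 := Measure.integral_comp_smul (μ := volume) (fun y => J (-(q / p) • x + y)) (√p)⁻¹
  rw [h1]
  have h3 : ∫ y, J (-(q / p) • x + y)
      = ((√p)⁻¹) ^ n * ∫ z, J (-(q / p) • x + (√p)⁻¹ • z) := by
    rw [h2, finrank_euclideanSpace_fin, inv_pow, inv_inv, abs_of_pos (by positivity), smul_eq_mul,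
      ← mul_assoc, inv_mul_cancel₀ (by positivity), one_mul]
  rw [h3, ← integral_const_mul]
  congr 1
  ext z
  rw [hJ]
  have e1 : p • (-(q / p) • x + (√p)⁻¹ • z) + q • x = √p • z := by
    have e2 : p * (√p)⁻¹ = √p := by
      rw [← div_eq_mul_inv, Real.div_sqrt]
    rw [smul_add, smul_smul, smul_smul, e2, mul_neg, mul_div_cancel₀ _ hp.ne', neg_smul]
    abel
  simp only [e1]
  rw [norm_smul, mul_pow, Real.norm_of_nonneg hsp.le, Real.sq_sqrt hp.le]
  have e3 : -(p * ‖z‖ ^ 2) / (2 * p) = -‖z‖ ^ 2 / 2 := by field_simp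
  have e4 : ((√p)⁻¹) ^ n * (p / (2 * π)) ^ ((n : ℝ) / 2) = (2 * π) ^ (-(n : ℝ) / 2) := by
    rw [div_eq_mul_inv, Real.mul_rpow hp.le (by positivity), inv_pow, Real.sqrt_eq_rpow,
      ← Real.rpow_natCast, ← Real.rpow_mul hp.le, Real.inv_rpow (by positivity), neg_div,
      Real.rpow_neg (by positivity), ← mul_assoc, show 1 / 2 * (n : ℝ) = n / 2 by ring,
      inv_mul_cancel₀ (by positivity), one_mul]
  rw [e3, ← e4]
  ring

end Gaussian

section Taylor

variable {ι : Type*} [Fintype ι]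

lemma abs_taylor_two_sub_le {φ φ' φ'' : ℝ → ℝ} {M : ℝ}
    (h1 : ∀ t ∈ Set.Icc (0 : ℝ) 1, HasDerivAt φ (φ' t) t)
    (h2 : ∀ t ∈ Set.Icc (0 : ℝ) 1, HasDerivAt φ' (φ'' t) t)
    (h3 : ∀ t ∈ Set.Icc (0 : ℝ) 1, |φ'' t - φ'' 0| ≤ M) :
    |φ 1 - φ 0 - φ' 0 - φ'' 0 / 2| ≤ M := by
  have h0 : (0 : ℝ) ∈ Set.Icc (0 : ℝ) 1 := by simp
  have hM : 0 ≤ M := (abs_nonneg _).trans (h3 0 h0)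
  have key : ∀ t ∈ Set.Icc (0 : ℝ) 1, |φ' t - φ' 0 - t * φ'' 0| ≤ M := by
    intro t ht
    have h := (convex_Icc (0 : ℝ) 1).norm_image_sub_le_of_norm_hasDerivWithin_le
      (f := fun s => φ' s - s * φ'' 0) (f' := fun s => φ'' s - 1 * φ'' 0) (C := M)
      (fun s hs => ((h2 s hs).sub ((hasDerivAt_id s).mul_const _)).hasDerivWithinAt)
      (fun s hs => by simpa using h3 s hs) h0 ht
    simp only [zero_mul, sub_zero, Real.norm_eq_abs] at h
    rw [sub_right_comm]
    exact h.trans (mul_le_of_le_one_right hM (by rw [abs_of_nonneg ht.1]; exact ht.2))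
  have h := (convex_Icc (0 : ℝ) 1).norm_image_sub_le_of_norm_hasDerivWithin_le
    (f := fun s => φ s - s * φ' 0 - s ^ 2 / 2 * φ'' 0)
    (f' := fun s => φ' s - 1 * φ' 0 - s * φ'' 0) (C := M)
    (fun s hs => by
      refine HasDerivAt.hasDerivWithinAt (((h1 s hs).sub ((hasDerivAt_id s).mul_const _)).sub
        (HasDerivAt.mul_const ?_ _))
      simpa using (hasDerivAt_pow 2 s).div_const 2)
    (fun s hs => by simpa using key s hs) h0 (y := 1) (by simp)
  convert h using 2 <;> norm_num
  ring_nf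

lemma hasPosTaylor_of_hasDerivAt {c : ι → ι → ℝ} {Φ : (ι → ℝ) → ℝ} {D : ι → (ι → ℝ) → ℝ}
    {D2 : ι → ι → (ι → ℝ) → ℝ} {l r : ι → ℝ}
    (h1 : ∀ x ∈ Set.Icc l r, ∀ d : ι → ℝ,
      HasDerivAt (fun t : ℝ => Φ (x + t • d)) (∑ i, D i x * d i) 0)
    (h2 : ∀ i, ∀ x ∈ Set.Icc l r, ∀ d : ι → ℝ,
      HasDerivAt (fun t : ℝ => D i (x + t • d)) (∑ j, D2 i j x * d j) 0)
    (h3 : ∀ i j, ∀ x ∈ Set.Icc l r, ContDiffAt ℝ 1 (D2 i j) x)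
    (hpos : ∀ x ∈ Set.Icc l r, ∀ ξ : ι → ℝ, 0 ≤ ∑ i, ∑ j, c i j * D2 i j x * (ξ i * ξ j)) :
    HasPosTaylor c Φ (Set.Icc l r) := by
  have hbd : ∀ i j, ∃ B, ∀ x ∈ Set.Icc l r, |D2 i j x| ≤ B := fun i j =>
    isCompact_Icc.exists_bound_of_continuousOn
      fun x hx => (h3 i j x hx).continuousAt.continuousWithinAt
  have hlip : ∀ i j, ∃ B, LipschitzOnWith B (D2 i j) (Set.Icc l r) := fun i j => by
    refine LocallyLipschitzOn.exists_lipschitzOnWith_of_compact isCompact_Icc fun x hx => ?_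
    obtain ⟨K, t, ht, hK⟩ := (h3 i j x hx).exists_lipschitzOnWith
    exact ⟨K, t, mem_nhdsWithin_of_mem_nhds ht, hK⟩
  choose B hB using hbd
  choose B' hB' using hlip
  set C : ℝ := ∑ i, ∑ j, (|B i j| + B' i j) with hC
  have hterm : ∀ i j, |B i j| + B' i j ≤ C := fun i j =>
    (Finset.single_le_sum (f := fun j => |B i j| + (B' i j : ℝ)) (fun j _ => by positivity)
      (Finset.mem_univ j)).trans
      (Finset.single_le_sum (f := fun i => ∑ j, (|B i j| + (B' i j : ℝ)))
        (fun i _ => Finset.sum_nonneg fun j _ => by positivity) (Finset.mem_univ i))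
  have hC0 : 0 ≤ C := Finset.sum_nonneg fun i _ => Finset.sum_nonneg fun j _ => by positivity
  refine ⟨C, hC0, fun m hm =>
    ⟨fun i => D i m, fun i j => D2 i j m / 2, fun i j => ?_, fun ξ => ?_, fun ω hω => ?_⟩⟩
  · rw [abs_div, abs_two]
    have := hB i j m hm
    linarith [hterm i j, le_abs_self (B i j), abs_nonneg (D2 i j m), (B' i j).coe_nonneg]
  · have := hpos m hm ξ
    have e : ∑ i, ∑ j, c i j * (D2 i j m / 2) * (ξ i * ξ j)
        = (∑ i, ∑ j, c i j * D2 i j m * (ξ i * ξ j)) / 2 := by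
      simp only [Finset.sum_div]
      exact Finset.sum_congr rfl fun i _ => Finset.sum_congr rfl fun j _ => by ring
    rw [e]
    positivity
  · set d := ω - m with hd
    have hseg : ∀ t ∈ Set.Icc (0 : ℝ) 1, m + t • d ∈ Set.Icc l r := fun t ht =>
      (convex_Icc l r).add_smul_sub_mem hm hω ht
    have hshift : ∀ {F : (ι → ℝ) → ℝ} {F' : ℝ} {t : ℝ},
        HasDerivAt (fun s : ℝ => F ((m + t • d) + s • d)) F' 0 →
        HasDerivAt (fun s : ℝ => F (m + s • d)) F' t := by
      intro F F' t h
      rw [← sub_self t] at h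
      refine (h.comp_sub_const t t).congr_of_eventuallyEq (Eventually.of_forall fun s => ?_)
      simp only [sub_smul]
      congr 1
      abel
    have hT := abs_taylor_two_sub_le (φ := fun t : ℝ => Φ (m + t • d))
      (φ' := fun t => ∑ i, D i (m + t • d) * d i)
      (φ'' := fun t => ∑ i, (∑ j, D2 i j (m + t • d) * d j) * d i) (M := C * ‖d‖ ^ 3)
      (fun t ht => hshift (h1 _ (hseg t ht) d))
      (fun t ht => HasDerivAt.fun_sum fun i _ => (hshift (h2 i _ (hseg t ht) d)).mul_const _)
      (fun t ht => by
        have hdi : ∀ i, |d i| ≤ ‖d‖ := fun i => norm_le_pi_norm d i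
        have ha : ∀ i j, |(D2 i j (m + t • d) - D2 i j (m + (0 : ℝ) • d)) * d j * d i|
            ≤ (|B i j| + B' i j) * ‖d‖ ^ 3 := by
          intro i j
          have h := (hB' i j).dist_le_mul _ (hseg t ht) _ (hseg 0 (by simp))
          rw [Real.dist_eq, zero_smul, add_zero, dist_eq_norm, add_sub_cancel_left, norm_smul,
            Real.norm_of_nonneg ht.1] at h
          rw [zero_smul, add_zero, abs_mul, abs_mul]
          have h' : |D2 i j (m + t • d) - D2 i j m| ≤ (|B i j| + B' i j) * ‖d‖ := by
            refine h.trans (mul_le_mul (by linarith [abs_nonneg (B i j)])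
              (mul_le_of_le_one_left (norm_nonneg _) ht.2)
              (mul_nonneg ht.1 (norm_nonneg _)) (by positivity))
          calc _ ≤ (|B i j| + B' i j) * ‖d‖ * ‖d‖ * ‖d‖ := by
                gcongr
                · exact hdi j
                · exact hdi i
            _ = _ := by ring
        have e : (∑ i, (∑ j, D2 i j (m + t • d) * d j) * d i)
              - ∑ i, (∑ j, D2 i j (m + (0 : ℝ) • d) * d j) * d i
            = ∑ i, ∑ j, (D2 i j (m + t • d) - D2 i j (m + (0 : ℝ) • d)) * d j * d i := by
          simp only [← Finset.sum_sub_distrib, Finset.sum_mul, sub_mul]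
        rw [e, hC, Finset.sum_mul]
        refine (Finset.abs_sum_le_sum_abs _ _).trans (Finset.sum_le_sum fun i _ => ?_)
        rw [Finset.sum_mul]
        exact (Finset.abs_sum_le_sum_abs _ _).trans (Finset.sum_le_sum fun j _ => ha i j))
    have hω' : m + d = ω := by rw [hd]; abel
    simp only [one_smul, zero_smul, add_zero, hω'] at hT
    have e : ∑ i, ∑ j, D2 i j m / 2 * ((ω i - m i) * (ω j - m j))
        = (∑ i, (∑ j, D2 i j m * d j) * d i) / 2 := by
      simp only [Finset.sum_div, Finset.sum_mul, hd, Pi.sub_apply]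
      exact Finset.sum_congr rfl fun i _ => Finset.sum_congr rfl fun j _ => by ring
    have e2 : ∑ i, D i m * (ω i - m i) = ∑ i, D i m * d i := rfl
    rw [e, e2]
    linarith [(abs_le.1 hT).1]

lemma hasDerivAt_exp_line {ψ : (ι → ℝ) → ℝ} {x d : ι → ℝ} {D : ι → ℝ}
    (h : HasDerivAt (fun t : ℝ => ψ (x + t • d)) (∑ i, D i * d i) 0) :
    HasDerivAt (fun t : ℝ => Real.exp (ψ (x + t • d))) (∑ i, Real.exp (ψ x) * D i * d i) 0 := by
  refine h.exp.congr_deriv ?_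
  simp [Finset.mul_sum, mul_assoc]

/-- The Taylor condition for `exp ψ` in terms of the first and second derivatives of `ψ`. -/
lemma hasPosTaylor_exp {c : ι → ι → ℝ} {ψ : (ι → ℝ) → ℝ} {D : ι → (ι → ℝ) → ℝ}
    {D2 : ι → ι → (ι → ℝ) → ℝ} {l r : ι → ℝ}
    (h1 : ∀ x ∈ Set.Icc l r, ∀ d : ι → ℝ,
      HasDerivAt (fun t : ℝ => ψ (x + t • d)) (∑ i, D i x * d i) 0)
    (h2 : ∀ i, ∀ x ∈ Set.Icc l r, ∀ d : ι → ℝ,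
      HasDerivAt (fun t : ℝ => D i (x + t • d)) (∑ j, D2 i j x * d j) 0)
    (hψ : ∀ x ∈ Set.Icc l r, ContDiffAt ℝ 1 ψ x)
    (hD : ∀ i, ∀ x ∈ Set.Icc l r, ContDiffAt ℝ 1 (D i) x)
    (hD2 : ∀ i j, ∀ x ∈ Set.Icc l r, ContDiffAt ℝ 1 (D2 i j) x)
    (hpos : ∀ x ∈ Set.Icc l r, ∀ ξ : ι → ℝ,
      0 ≤ ∑ i, ∑ j, c i j * (D i x * D j x + D2 i j x) * (ξ i * ξ j)) :
    HasPosTaylor c (fun x => Real.exp (ψ x)) (Set.Icc l r) := by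
  refine hasPosTaylor_of_hasDerivAt (D := fun i x => Real.exp (ψ x) * D i x)
    (D2 := fun i j x => Real.exp (ψ x) * (D i x * D j x + D2 i j x))
    (fun x hx d => hasDerivAt_exp_line (h1 x hx d)) (fun i x hx d => ?_) (fun i j x hx => ?_)
    (fun x hx ξ => ?_)
  · refine ((hasDerivAt_exp_line (h1 x hx d)).mul (h2 i x hx d)).congr_deriv ?_
    simp only [zero_smul, add_zero, Finset.mul_sum, Finset.sum_mul]
    rw [← Finset.sum_add_distrib]
    exact Finset.sum_congr rfl fun j _ => by ring
  · exact (hψ x hx).exp.mul (((hD i x hx).mul (hD j x hx)).add (hD2 i j x hx))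
  · have e : ∑ i, ∑ j, c i j * (Real.exp (ψ x) * (D i x * D j x + D2 i j x)) * (ξ i * ξ j)
        = Real.exp (ψ x) * ∑ i, ∑ j, c i j * (D i x * D j x + D2 i j x) * (ξ i * ξ j) := by
      simp only [Finset.mul_sum]
      exact Finset.sum_congr rfl fun i _ => Finset.sum_congr rfl fun j _ => by ring
    rw [e]
    exact mul_nonneg (Real.exp_nonneg _) (hpos x hx ξ)

end Taylor

lemma eventually_exponent_bounds {α β : ℝ} (hβ : 0 < β) (hβα : β < α) (hα : α < 1)
    (hαβ : 1 < α + β) (B : ℝ) :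
    ∀ᶠ R : ℝ in atTop, 2 < R ∧ 1 ≤ R ^ β ∧ 2 * R ^ α ≤ R ∧ B ≤ R ^ α / (R - R ^ α) * R ^ β ∧
      B ≤ R ^ α / (R - R ^ α) * ((R - 1) / R ^ β) := by
  have h1 := (tendsto_rpow_atTop (y := 1 - α) (by linarith)).eventually_ge_atTop 2
  have h2 := (tendsto_rpow_atTop (y := α + β - 1) (by linarith)).eventually_ge_atTop B
  have h3 := (tendsto_rpow_atTop (y := α - β) (by linarith)).eventually_ge_atTop (2 * B)
  filter_upwards [h1, h2, h3, eventually_gt_atTop 2] with R h1 h2 h3 hR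
  have hR0 : 0 < R := by linarith
  have hα0 : 0 < R ^ α := Real.rpow_pos_of_pos hR0 _
  have hβ0 : 0 < R ^ β := Real.rpow_pos_of_pos hR0 _
  have e1 : R ^ (1 - α) * R ^ α = R := by
    rw [← Real.rpow_add hR0]; simp
  have h4 : 2 * R ^ α ≤ R := by nlinarith
  have h5 : R ^ α / R ≤ R ^ α / (R - R ^ α) :=
    div_le_div_of_nonneg_left hα0.le (by linarith) (by linarith)
  refine ⟨hR, Real.one_le_rpow (by linarith) hβ.le, h4, ?_, ?_⟩
  · refine (h2.trans_eq ?_).trans (mul_le_mul_of_nonneg_right h5 hβ0.le)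
    rw [Real.rpow_sub hR0, Real.rpow_add hR0, Real.rpow_one]
    ring
  · have h6 : R ^ α / R * ((R - 1) / R ^ β) ≤ R ^ α / (R - R ^ α) * ((R - 1) / R ^ β) :=
      mul_le_mul_of_nonneg_right h5 (div_nonneg (by linarith) hβ0.le)
    refine le_trans ?_ h6
    have e2 : R ^ α / R * ((R - 1) / R ^ β) = R ^ (α - β) * ((R - 1) / R) := by
      rw [Real.rpow_sub hR0]; ring
    rw [e2]
    have h7 : 1 / 2 ≤ (R - 1) / R := by rw [div_le_div_iff₀ (by norm_num) hR0]; linarith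
    nlinarith [Real.rpow_pos_of_pos hR0 (α - β)]

lemma abs_mul_le_of_abs_le {x y C D : ℝ} (hx : |x| ≤ C) (hy : |y| ≤ D) : -(C * D) ≤ x * y := by
  have h : |x * y| ≤ C * D := by
    rw [abs_mul]
    exact mul_le_mul hx hy (abs_nonneg _) ((abs_nonneg _).trans hx)
  exact (abs_le.1 h).1

lemma quadratic_form_nonneg {a p S κ N : ℝ} (hκ0 : 0 < κ) (hκ1 : κ ≤ 1) (hp : 1 ≤ p)
    (hN0 : 0 ≤ N) (hNp : 8 * N ≤ κ * p) (hNS : N ^ 2 + a ^ 2 + 2 * N ≤ κ * S) (x y : ℝ) :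
    N * (x * y + y ^ 2) + N * (x ^ 2 + y ^ 2) / p
      ≤ κ * (x ^ 2 / 2 - a ^ 2 * y ^ 2) + S * y ^ 2 := by
  have f3 : N * (x ^ 2 + y ^ 2) / p ≤ κ / 8 * x ^ 2 + N * y ^ 2 := by
    rw [div_le_iff₀ (by linarith)]
    have k1 : N * x ^ 2 ≤ κ * p / 8 * x ^ 2 :=
      mul_le_mul_of_nonneg_right (by linarith) (sq_nonneg _)
    have k2 : N * y ^ 2 ≤ N * y ^ 2 * p := le_mul_of_one_le_right (by positivity) hp
    calc N * (x ^ 2 + y ^ 2) = N * x ^ 2 + N * y ^ 2 := by ring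
      _ ≤ κ * p / 8 * x ^ 2 + N * y ^ 2 * p := add_le_add k1 k2
      _ = _ := by ring
  have f5 : 0 ≤ κ * (3 * κ / 8 * x ^ 2 - N * (x * y) + (S - κ * a ^ 2 - 2 * N) * y ^ 2) := by
    have k0 : N ^ 2 ≤ κ * S - κ * (κ * a ^ 2) - κ * (2 * N) := by
      have k1 : κ * (κ * a ^ 2) ≤ a ^ 2 :=
        (mul_le_of_le_one_left (by positivity) hκ1).trans
          (mul_le_of_le_one_left (sq_nonneg _) hκ1)
      have k2 : κ * (2 * N) ≤ 2 * N := mul_le_of_le_one_left (by positivity) hκ1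
      linarith
    have k1 := mul_le_mul_of_nonneg_right k0 (sq_nonneg y)
    have k2 := sq_nonneg (κ * x / 2 - N * y)
    have k3 := sq_nonneg (κ * x)
    calc (0 : ℝ) ≤ (κ * x) ^ 2 / 8 + (κ * x / 2 - N * y) ^ 2
          + ((κ * S - κ * (κ * a ^ 2) - κ * (2 * N)) * y ^ 2 - N ^ 2 * y ^ 2) := by linarith
      _ = _ := by ring
  have f6 := nonneg_of_mul_nonneg_right f5 hκ0
  have e : κ * (x ^ 2 / 2 - a ^ 2 * y ^ 2) + S * y ^ 2
      = (3 * κ / 8 * x ^ 2 - N * (x * y) + (S - κ * a ^ 2 - 2 * N) * y ^ 2)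
        + (κ / 8 * x ^ 2 + N * y ^ 2) + N * (x * y + y ^ 2) := by ring
  linarith

lemma neg_le_first_order_error {a b σ C A₁ A₂ : ℝ} (ha : 0 < a) (hb : 0 < b) (hσ : |σ| = 1)
    (h₁ : |A₁| ≤ C) (h₂ : |A₂| ≤ C) (τ d : ℝ) :
    -(C * (2 * a * (a + b) + 8) * (|τ| * |d| + |d| ^ 2))
      ≤ A₁ * (a ^ 2 * (2 * τ * d + d ^ 2)) + A₂ * (2 * σ * a * b * (τ * d)) := by
  have hC : 0 ≤ C := (abs_nonneg _).trans h₁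
  have b1 : |a ^ 2 * (2 * τ * d + d ^ 2)| ≤ a ^ 2 * (2 * (|τ| * |d|) + |d| ^ 2) := by
    rw [abs_mul, abs_of_pos (by positivity : 0 < a ^ 2)]
    refine mul_le_mul_of_nonneg_left ((abs_add_le _ _).trans_eq ?_) (by positivity)
    rw [mul_assoc, abs_mul, abs_mul, abs_two, abs_of_nonneg (sq_nonneg d), sq_abs]
  have b2 : |2 * σ * a * b * (τ * d)| ≤ 2 * a * b * (|τ| * |d|) := by
    rw [abs_mul, abs_mul, abs_mul, abs_mul, abs_mul, abs_two, hσ, abs_of_pos ha, abs_of_pos hb,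
      mul_one]
  have c1 := abs_mul_le_of_abs_le h₁ b1
  have c2 := abs_mul_le_of_abs_le h₂ b2
  have e : C * (2 * a * (a + b) + 8) * (|τ| * |d| + |d| ^ 2)
      = C * (a ^ 2 * (2 * (|τ| * |d|) + |d| ^ 2)) + C * (2 * a * b * (|τ| * |d|))
        + C * (a ^ 2 * |d| ^ 2 + 2 * a * b * |d| ^ 2 + 8 * (|τ| * |d| + |d| ^ 2)) := by ring
  have e' : 0 ≤ C * (a ^ 2 * |d| ^ 2 + 2 * a * b * |d| ^ 2 + 8 * (|τ| * |d| + |d| ^ 2)) := by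
    positivity
  linarith

lemma neg_le_second_order_error {a b C A₁ A₂ A₃ : ℝ} (ha : 0 < a) (hb : 0 < b)
    (h₁ : |A₁| ≤ C) (h₂ : |A₂| ≤ C) (h₃ : |A₃| ≤ C) (τ d : ℝ) :
    -(C * (2 * a * (a + b) + 8) * (|τ| ^ 2 + |d| ^ 2))
      ≤ A₁ * (τ + d) ^ 2 + A₂ * (-(2 * ((τ + d) * τ))) + A₃ * τ ^ 2 := by
  have hC : 0 ≤ C := (abs_nonneg _).trans h₁
  have hsum : |τ + d| ≤ |τ| + |d| := abs_add_le _ _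
  have b3 : |(τ + d) ^ 2| ≤ (|τ| + |d|) ^ 2 := by
    rw [abs_pow]; gcongr
  have b4 : |(-(2 * ((τ + d) * τ)))| ≤ 2 * ((|τ| + |d|) * |τ|) := by
    rw [abs_neg, abs_mul, abs_mul, abs_two]; gcongr
  have b5 : |τ ^ 2| ≤ |τ| ^ 2 := by rw [abs_pow]
  have c3 := abs_mul_le_of_abs_le h₁ b3
  have c4 := abs_mul_le_of_abs_le h₂ b4
  have c5 := abs_mul_le_of_abs_le h₃ b5
  have e : C * (2 * a * (a + b) + 8) * (|τ| ^ 2 + |d| ^ 2)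
      = C * (|τ| + |d|) ^ 2 + C * (2 * ((|τ| + |d|) * |τ|)) + C * |τ| ^ 2
        + C * (2 * a * (a + b) * (|τ| ^ 2 + |d| ^ 2) + 2 * (|τ| - |d|) ^ 2
          + 2 * |τ| ^ 2 + 5 * |d| ^ 2) := by ring
  have e' : 0 ≤ C * (2 * a * (a + b) * (|τ| ^ 2 + |d| ^ 2) + 2 * (|τ| - |d|) ^ 2
      + 2 * |τ| ^ 2 + 5 * |d| ^ 2) := by positivity
  linarith

/-- The quadratic inequality behind the convexity of the perturbed functional. -/
lemma quadratic_nonneg {a b σ p S κ h M C A₁ A₂ A₃ : ℝ} (ha : 0 < a) (hb : 0 < b)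
    (hσ : (a + σ * b) ^ 2 = 1) (hσ2 : |σ| = 1) (hh : 0 < h) (hhM : h ≤ M) (h₁ : |A₁| ≤ C)
    (h₂ : |A₂| ≤ C) (h₃ : |A₃| ≤ C) (hpde : 0 ≤ a ^ 2 * A₁ + 2 * a * b * σ * A₂ + b ^ 2 * A₃)
    (hκ0 : 0 < κ) (hκ1 : κ ≤ 1) (hp : 1 ≤ p)
    {N : ℝ} (hN : N = M * (C * (2 * a * (a + b) + 8)))
    (hNp : 8 * N ≤ κ * p) (hNS : N ^ 2 + a ^ 2 + 2 * N ≤ κ * S) (w v : ℝ) :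
    0 ≤ κ * (w + σ * v) ^ 2 + S * (w / a - v / b) ^ 2
      + h * ((1 + 1 / (a ^ 2 * p)) * A₁ * w ^ 2 + 2 * (σ - 1 / (a * b * p)) * A₂ * (w * v)
        + (1 + 1 / (b ^ 2 * p)) * A₃ * v ^ 2) := by
  obtain ⟨τ, rfl⟩ : ∃ τ, v = b * τ := ⟨v / b, by field_simp⟩
  obtain ⟨d, rfl⟩ : ∃ d, w = a * (τ + d) := ⟨w / a - τ, by field_simp; ring⟩
  have hp0 : 0 < p := by linarith
  have hC : 0 ≤ C := (abs_nonneg _).trans h₁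
  have hM : 0 < M := hh.trans_le hhM
  have hN0 : 0 ≤ N := by rw [hN]; positivity
  have d1 := neg_le_first_order_error ha hb hσ2 h₁ h₂ τ d
  have d2 := div_le_div_of_nonneg_right (neg_le_second_order_error ha hb h₁ h₂ h₃ τ d) hp0.le
  have d3 := quadratic_form_nonneg hκ0 hκ1 hp hN0 hNp hNS |τ| |d|
  set C₁ := C * (2 * a * (a + b) + 8) with hC₁
  have hC₁0 : 0 ≤ C₁ := by positivity
  have e0 : a * (τ + d) / a - b * τ / b = d := by field_simp; ring
  have e1 : (1 + 1 / (a ^ 2 * p)) * A₁ * (a * (τ + d)) ^ 2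
        + 2 * (σ - 1 / (a * b * p)) * A₂ * (a * (τ + d) * (b * τ))
        + (1 + 1 / (b ^ 2 * p)) * A₃ * (b * τ) ^ 2
      = (a ^ 2 * A₁ + 2 * a * b * σ * A₂ + b ^ 2 * A₃) * τ ^ 2
        + (A₁ * (a ^ 2 * (2 * τ * d + d ^ 2)) + A₂ * (2 * σ * a * b * (τ * d)))
        + (A₁ * (τ + d) ^ 2 + A₂ * (-(2 * ((τ + d) * τ))) + A₃ * τ ^ 2) / p := by
    field_simp
    ring
  rw [e0, e1]
  have hpde' := mul_nonneg hpde (sq_nonneg τ)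
  have g0 : -(C₁ * (|τ| * |d| + |d| ^ 2) + C₁ * (|τ| ^ 2 + |d| ^ 2) / p) ≤
      (a ^ 2 * A₁ + 2 * a * b * σ * A₂ + b ^ 2 * A₃) * τ ^ 2
        + (A₁ * (a ^ 2 * (2 * τ * d + d ^ 2)) + A₂ * (2 * σ * a * b * (τ * d)))
        + (A₁ * (τ + d) ^ 2 + A₂ * (-(2 * ((τ + d) * τ))) + A₃ * τ ^ 2) / p := by
    rw [neg_div] at d2
    linarith
  have g1 := mul_le_mul_of_nonneg_left g0 hh.le
  have g2 : h * (C₁ * (|τ| * |d| + |d| ^ 2) + C₁ * (|τ| ^ 2 + |d| ^ 2) / p)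
      ≤ M * (C₁ * (|τ| * |d| + |d| ^ 2) + C₁ * (|τ| ^ 2 + |d| ^ 2) / p) :=
    mul_le_mul_of_nonneg_right hhM (by positivity)
  have g3 : M * (C₁ * (|τ| * |d| + |d| ^ 2) + C₁ * (|τ| ^ 2 + |d| ^ 2) / p)
      = N * (|τ| * |d| + |d| ^ 2) + N * (|τ| ^ 2 + |d| ^ 2) / p := by rw [hN]; ring
  have f2 : |τ| ^ 2 / 2 - a ^ 2 * |d| ^ 2 ≤ (a * (τ + d) + σ * (b * τ)) ^ 2 := by
    have e : (a * (τ + d) + σ * (b * τ)) ^ 2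
        = (a + σ * b) ^ 2 * τ ^ 2 / 2 - a ^ 2 * d ^ 2
          + ((a + σ * b) * τ + 2 * a * d) ^ 2 / 2 := by ring
    rw [e, hσ, sq_abs, sq_abs]
    have := sq_nonneg ((a + σ * b) * τ + 2 * a * d)
    linarith
  have f4 := mul_le_mul_of_nonneg_left f2 hκ0.le
  rw [mul_neg] at g1
  rw [← sq_abs d]
  rw [← sq_abs d] at g1
  linarith

section PartialDerivatives

variable {H : ℝ × ℝ → ℝ} {z : ℝ × ℝ}

lemma ContDiffAt.fderiv_apply_const {m n : WithTop ℕ∞} (h : ContDiffAt ℝ n H z) (hmn : m + 1 ≤ n)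
    (v : ℝ × ℝ) : ContDiffAt ℝ m (fun z => fderiv ℝ H z v) z :=
  (h.fderiv_right hmn).clm_apply contDiffAt_const

lemma fderiv_fderiv_apply (h : ContDiffAt ℝ 2 H z) (v u : ℝ × ℝ) :
    fderiv ℝ (fun z => fderiv ℝ H z v) z u = fderiv ℝ (fderiv ℝ H) z u v := by
  have hd : DifferentiableAt ℝ (fderiv ℝ H) z :=
    (h.fderiv_right (m := 1) (by norm_num)).differentiableAt (by simp)
  rw [fderiv_clm_apply hd (differentiableAt_const _)]
  simp

lemma fderiv_Hy_fst (h : ContDiffAt ℝ 2 H z) : fderiv ℝ (Hy H) z (1, 0) = Hxy H z := by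
  have e := fderiv_fderiv_apply h (0, 1) (1, 0)
  rw [h.isSymmSndFDerivAt (by simp) (1, 0) (0, 1), ← fderiv_fderiv_apply h] at e
  exact e

lemma exists_bound_fderiv_fderiv {K : Set (ℝ × ℝ)} (hK : IsCompact K) (hK' : UniqueDiffOn ℝ K)
    (hH : ContDiffOn ℝ 2 H K) :
    ∃ C, ∀ z ∈ interior K, ∀ v u : ℝ × ℝ, ‖v‖ ≤ 1 → ‖u‖ ≤ 1 →
      |fderiv ℝ (fun z => fderiv ℝ H z v) z u| ≤ C := by
  obtain ⟨C, hC⟩ := hK.exists_bound_of_continuousOn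
    (hH.continuousOn_iteratedFDerivWithin (m := 2) le_rfl hK')
  refine ⟨C, fun z hz v u hv hu => ?_⟩
  have hc := hH.contDiffAt (mem_interior_iff_mem_nhds.1 hz)
  have hle := hC z (interior_subset hz)
  rw [iteratedFDerivWithin_eq_iteratedFDeriv hK' (n := 2) hc (interior_subset hz)] at hle
  have e := iteratedFDeriv_two_apply (𝕜 := ℝ) H z ![u, v]
  simp only [Matrix.cons_val_zero, Matrix.cons_val_one] at e
  rw [fderiv_fderiv_apply hc, ← e, ← Real.norm_eq_abs]
  refine ((iteratedFDeriv ℝ 2 H z).le_opNorm _).trans ?_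
  rw [Fin.prod_univ_two]
  exact (mul_le_of_le_one_right (norm_nonneg _) (mul_le_one₀ hu (norm_nonneg _) hv)).trans hle

lemma hasDerivAt_line {F : ℝ × ℝ → ℝ} {x : Fin 3 → ℝ} (h : DifferentiableAt ℝ F (x 0, x 1))
    (d : Fin 3 → ℝ) :
    HasDerivAt (fun t : ℝ => F ((x + t • d) 0, (x + t • d) 1))
      (fderiv ℝ F (x 0, x 1) (1, 0) * d 0 + fderiv ℝ F (x 0, x 1) (0, 1) * d 1) 0 := by
  have h0 : ∀ i, HasDerivAt (fun t : ℝ => (x + t • d) i) (d i) 0 := fun i => by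
    simpa using ((hasDerivAt_id (0 : ℝ)).mul_const (d i)).const_add (x i)
  have h1 := ((h0 0).prodMk (h0 1))
  have h2 : HasFDerivAt F (fderiv ℝ F (x 0, x 1)) ((x + (0 : ℝ) • d) 0, (x + (0 : ℝ) • d) 1) := by
    simpa using h.hasFDerivAt
  refine (h2.comp_hasDerivAt (0 : ℝ) h1).congr_deriv ?_
  have e : (d 0, d 1) = d 0 • ((1, 0) : ℝ × ℝ) + d 1 • ((0, 1) : ℝ × ℝ) := by simp
  rw [e, map_add, map_smul, map_smul, smul_eq_mul, smul_eq_mul]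
  ring

end PartialDerivatives

section Potential

/-- The gradient of `x ↦ R * log (H (x 0, x 1)) - m * log (x 2)`. -/
def potentialGrad (H : ℝ × ℝ → ℝ) (R m : ℝ) (i : Fin 3) (x : Fin 3 → ℝ) : ℝ :=
  ![R * (Hx H (x 0, x 1) / H (x 0, x 1)), R * (Hy H (x 0, x 1) / H (x 0, x 1)), -(m / x 2)] i

/-- The Hessian of `x ↦ R * log (H (x 0, x 1)) - m * log (x 2)`. -/
def potentialHess (H : ℝ × ℝ → ℝ) (R m : ℝ) (i j : Fin 3) (x : Fin 3 → ℝ) : ℝ :=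
  ![![R * (Hxx H (x 0, x 1) / H (x 0, x 1) - Hx H (x 0, x 1) ^ 2 / H (x 0, x 1) ^ 2),
      R * (Hxy H (x 0, x 1) / H (x 0, x 1)
        - Hx H (x 0, x 1) * Hy H (x 0, x 1) / H (x 0, x 1) ^ 2), 0],
    ![R * (Hxy H (x 0, x 1) / H (x 0, x 1)
        - Hx H (x 0, x 1) * Hy H (x 0, x 1) / H (x 0, x 1) ^ 2),
      R * (Hyy H (x 0, x 1) / H (x 0, x 1) - Hy H (x 0, x 1) ^ 2 / H (x 0, x 1) ^ 2), 0],
    ![0, 0, m / x 2 ^ 2]] i j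

variable {H : ℝ × ℝ → ℝ} {R m : ℝ}

lemma hasPosTaylor_exp_potential {c : Fin 3 → Fin 3 → ℝ} {l r : Fin 3 → ℝ}
    (hH : ∀ x ∈ Set.Icc l r, ContDiffAt ℝ 3 H (x 0, x 1))
    (hH0 : ∀ x ∈ Set.Icc l r, H (x 0, x 1) ≠ 0) (hx2 : ∀ x ∈ Set.Icc l r, x 2 ≠ 0)
    (hpos : ∀ x ∈ Set.Icc l r, ∀ ξ : Fin 3 → ℝ,
      0 ≤ ∑ i, ∑ j, c i j * (potentialGrad H R m i x * potentialGrad H R m j x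
        + potentialHess H R m i j x) * (ξ i * ξ j)) :
    HasPosTaylor c (fun x => Real.exp (R * Real.log (H (x 0, x 1)) - m * Real.log (x 2)))
      (Set.Icc l r) := by
  have hl : ∀ (x d : Fin 3 → ℝ), HasDerivAt (fun t : ℝ => (x + t • d) 2) (d 2) 0 := fun x d => by
    simpa using ((hasDerivAt_id (0 : ℝ)).mul_const (d 2)).const_add (x 2)
  have hpr : ∀ (x : Fin 3 → ℝ) n, ContDiffAt ℝ n (fun x : Fin 3 → ℝ => (x 0, x 1)) x :=
    fun x n => (contDiff_apply ℝ ℝ 0).contDiffAt.prodMk (contDiff_apply ℝ ℝ 1).contDiffAt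
  have hpr2 : ∀ (x : Fin 3 → ℝ) n, ContDiffAt ℝ n (fun x : Fin 3 → ℝ => x 2) x :=
    fun x n => (contDiff_apply ℝ ℝ 2).contDiffAt
  have cH : ∀ x ∈ Set.Icc l r, ContDiffAt ℝ 1 (fun x : Fin 3 → ℝ => H (x 0, x 1)) x :=
    fun x hx => ((hH x hx).of_le (by norm_num)).comp x (hpr x 1)
  have cD : ∀ v, ∀ x ∈ Set.Icc l r, ContDiffAt ℝ 2 (fun z => fderiv ℝ H z v) (x 0, x 1) :=
    fun v x hx => (hH x hx).fderiv_apply_const (by norm_num) v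
  have cD1 : ∀ v, ∀ x ∈ Set.Icc l r,
      ContDiffAt ℝ 1 (fun x : Fin 3 → ℝ => fderiv ℝ H (x 0, x 1) v) x :=
    fun v x hx => ContDiffAt.comp (g := fun z => fderiv ℝ H z v) x
      ((cD v x hx).of_le (by norm_num)) (hpr x 1)
  have cDD : ∀ v u, ∀ x ∈ Set.Icc l r, ContDiffAt ℝ 1
      (fun x : Fin 3 → ℝ => fderiv ℝ (fun z => fderiv ℝ H z v) (x 0, x 1) u) x :=
    fun v u x hx => ContDiffAt.comp (g := fun z => fderiv ℝ (fun z => fderiv ℝ H z v) z u) x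
      ((cD v x hx).fderiv_apply_const (m := 1) (by norm_num) u) (hpr x 1)
  have lH : ∀ x ∈ Set.Icc l r, ∀ d : Fin 3 → ℝ,
      HasDerivAt (fun t : ℝ => H ((x + t • d) 0, (x + t • d) 1))
        (Hx H (x 0, x 1) * d 0 + Hy H (x 0, x 1) * d 1) 0 :=
    fun x hx d => hasDerivAt_line ((hH x hx).differentiableAt (by norm_num)) d
  have lHx : ∀ x ∈ Set.Icc l r, ∀ d : Fin 3 → ℝ,
      HasDerivAt (fun t : ℝ => Hx H ((x + t • d) 0, (x + t • d) 1))
        (Hxx H (x 0, x 1) * d 0 + Hxy H (x 0, x 1) * d 1) 0 :=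
    fun x hx d => hasDerivAt_line ((cD (1, 0) x hx).differentiableAt (by norm_num)) d
  have lHy : ∀ x ∈ Set.Icc l r, ∀ d : Fin 3 → ℝ,
      HasDerivAt (fun t : ℝ => Hy H ((x + t • d) 0, (x + t • d) 1))
        (Hxy H (x 0, x 1) * d 0 + Hyy H (x 0, x 1) * d 1) 0 := fun x hx d => by
    rw [← fderiv_Hy_fst ((hH x hx).of_le (by norm_num))]
    exact hasDerivAt_line ((cD (0, 1) x hx).differentiableAt (by norm_num)) d
  refine hasPosTaylor_exp (D := potentialGrad H R m) (D2 := potentialHess H R m)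
    (fun x hx d => ?_) (fun i x hx d => ?_) (fun x hx => ?_) (fun i x hx => ?_)
    (fun i j x hx => ?_) hpos
  · have hH0' := hH0 x hx
    have hx2' := hx2 x hx
    refine ((((lH x hx d).log (by simpa using hH0')).const_mul R).sub
      (((hl x d).log (by simpa using hx2')).const_mul m)).congr_deriv ?_
    simp [potentialGrad, Fin.sum_univ_three]
    ring
  · have hH0' := hH0 x hx
    have hx2' := hx2 x hx
    fin_cases i
    · refine (((lHx x hx d).div (lH x hx d) (by simpa using hH0')).const_mul R).congr_deriv ?_
      simp [potentialHess, Fin.sum_univ_three]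
      field_simp
      ring
    · refine (((lHy x hx d).div (lH x hx d) (by simpa using hH0')).const_mul R).congr_deriv ?_
      simp [potentialHess, Fin.sum_univ_three]
      field_simp
      ring
    · refine (((hasDerivAt_const (0 : ℝ) m).div (hl x d)
        (by simpa using hx2')).neg).congr_deriv ?_
      simp [potentialHess, Fin.sum_univ_three]
      ring
  · exact (contDiffAt_const.mul ((cH x hx).log (hH0 x hx))).sub
      (contDiffAt_const.mul ((hpr2 x 1).log (hx2 x hx)))
  · fin_cases i
    · exact contDiffAt_const.mul ((cD1 (1, 0) x hx).div (cH x hx) (hH0 x hx))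
    · exact contDiffAt_const.mul ((cD1 (0, 1) x hx).div (cH x hx) (hH0 x hx))
    · exact (contDiffAt_const.div (hpr2 x 1) (hx2 x hx)).neg
  · have hsub : ∀ v u w, ContDiffAt ℝ 1 (fun x : Fin 3 → ℝ =>
        R * (fderiv ℝ (fun z => fderiv ℝ H z v) (x 0, x 1) u / H (x 0, x 1)
          - fderiv ℝ H (x 0, x 1) v * fderiv ℝ H (x 0, x 1) w / H (x 0, x 1) ^ 2)) x :=
      fun v u w => contDiffAt_const.mul (((cDD v u x hx).div (cH x hx) (hH0 x hx)).sub
        (((cD1 v x hx).mul (cD1 w x hx)).div ((cH x hx).pow 2) (pow_ne_zero 2 (hH0 x hx))))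
    have hsq : ∀ v, ContDiffAt ℝ 1 (fun x : Fin 3 → ℝ =>
        R * (fderiv ℝ (fun z => fderiv ℝ H z v) (x 0, x 1) v / H (x 0, x 1)
          - fderiv ℝ H (x 0, x 1) v ^ 2 / H (x 0, x 1) ^ 2)) x := fun v => by
      simpa only [pow_two] using hsub v v v
    fin_cases i <;> fin_cases j
    · exact hsq (1, 0)
    · exact hsub (1, 0) (0, 1) (0, 1)
    · exact contDiffAt_const
    · exact hsub (1, 0) (0, 1) (0, 1)
    · exact hsq (0, 1)
    · exact contDiffAt_const
    · exact contDiffAt_const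
    · exact contDiffAt_const
    · exact contDiffAt_const.div ((hpr2 x 1).pow 2) (pow_ne_zero 2 (hx2 x hx))

/-- The quadratic form of the potential along a Gaussian covariance, after completing the square
in the third variable. -/
lemma sum_potential_nonneg {c : Fin 3 → Fin 3 → ℝ} {a b p ε s σ : ℝ} (x : Fin 3 → ℝ)
    (hε : ε ^ 2 = 1) (hs : s ^ 2 = 1) (hσ : σ = ε * s) (hR : 0 < R) (hm : 0 < m)
    (hp : p ≠ 0) (ha : a ≠ 0) (hb : b ≠ 0)
    (h00 : c 0 0 = 1 + 1 / (a ^ 2 * p)) (h01 : c 0 1 = σ - 1 / (a * b * p))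
    (h10 : c 1 0 = σ - 1 / (a * b * p)) (h11 : c 1 1 = 1 + 1 / (b ^ 2 * p))
    (h02 : c 0 2 = ε) (h20 : c 2 0 = ε) (h12 : c 1 2 = s) (h21 : c 2 1 = s) (h22 : c 2 2 = 1)
    (hH : H (x 0, x 1) ≠ 0) (hP : Hx H (x 0, x 1) ≠ 0) (hQ : Hy H (x 0, x 1) ≠ 0)
    (hx2 : x 2 ≠ 0)
    (hquad : ∀ w v : ℝ, 0 ≤ (R / (m + 1) - 1) * (w + σ * v) ^ 2
      + (R - 1) / p * (w / a - v / b) ^ 2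
      + H (x 0, x 1) * ((1 + 1 / (a ^ 2 * p)) * (Hxx H (x 0, x 1) / Hx H (x 0, x 1) ^ 2) * w ^ 2
        + 2 * (σ - 1 / (a * b * p))
          * (Hxy H (x 0, x 1) / (Hx H (x 0, x 1) * Hy H (x 0, x 1))) * (w * v)
        + (1 + 1 / (b ^ 2 * p)) * (Hyy H (x 0, x 1) / Hy H (x 0, x 1) ^ 2) * v ^ 2))
    (ξ : Fin 3 → ℝ) :
    0 ≤ ∑ i, ∑ j, c i j * (potentialGrad H R m i x * potentialGrad H R m j x
        + potentialHess H R m i j x) * (ξ i * ξ j) := by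
  simp only [Fin.sum_univ_three, h00, h01, h10, h11, h02, h20, h12, h21, h22, potentialGrad,
    potentialHess, Matrix.cons_val]
  generalize H (x 0, x 1) = h at *
  generalize Hx H (x 0, x 1) = P at *
  generalize Hy H (x 0, x 1) = Q at *
  obtain ⟨A₁, e₁⟩ : ∃ A, Hxx H (x 0, x 1) = A * P ^ 2 :=
    ⟨_, (div_mul_cancel₀ _ (by positivity)).symm⟩
  obtain ⟨A₂, e₂⟩ : ∃ A, Hxy H (x 0, x 1) = A * (P * Q) :=
    ⟨_, (div_mul_cancel₀ _ (by positivity)).symm⟩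
  obtain ⟨A₃, e₃⟩ : ∃ A, Hyy H (x 0, x 1) = A * Q ^ 2 :=
    ⟨_, (div_mul_cancel₀ _ (by positivity)).symm⟩
  have hq := hquad (P * ξ 0) (Q * ξ 1)
  rw [e₁, e₂, e₃, mul_div_cancel_right₀ _ (by positivity), mul_div_cancel_right₀ _ (by positivity),
    mul_div_cancel_right₀ _ (by positivity)] at hq
  rw [e₁, e₂, e₃]
  generalize x 2 = k at *
  generalize ξ 0 = ξ0 at *
  generalize ξ 1 = ξ1 at *
  generalize ξ 2 = ξ2 at *
  have hL : (ε * (P * ξ0) + s * (Q * ξ1)) ^ 2 = (P * ξ0 + σ * (Q * ξ1)) ^ 2 := by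
    rw [hσ]
    linear_combination ((P * ξ0) ^ 2) * hε - s ^ 2 * (Q * ξ1) ^ 2 * hε
  have hσ2 : σ ^ 2 = 1 := by rw [hσ, mul_pow, hε, hs, one_mul]
  calc 0 ≤ R / h ^ 2 * ((R / (m + 1) - 1) * (P * ξ0 + σ * (Q * ξ1)) ^ 2
      + (R - 1) / p * (P * ξ0 / a - Q * ξ1 / b) ^ 2
      + h * ((1 + 1 / (a ^ 2 * p)) * A₁ * (P * ξ0) ^ 2
        + 2 * (σ - 1 / (a * b * p)) * A₂ * (P * ξ0 * (Q * ξ1))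
        + (1 + 1 / (b ^ 2 * p)) * A₃ * (Q * ξ1) ^ 2))
      + m * (m + 1) * (ξ2 / k - R / h * (ε * (P * ξ0) + s * (Q * ξ1)) / (m + 1)) ^ 2 := by
        positivity
    _ = R / h ^ 2 * ((R / (m + 1) - 1) * (P * ξ0 + σ * (Q * ξ1)) ^ 2
      + (R - 1) / p * (P * ξ0 / a - Q * ξ1 / b) ^ 2
      + h * ((1 + 1 / (a ^ 2 * p)) * A₁ * (P * ξ0) ^ 2
        + 2 * (σ - 1 / (a * b * p)) * A₂ * (P * ξ0 * (Q * ξ1))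
        + (1 + 1 / (b ^ 2 * p)) * A₃ * (Q * ξ1) ^ 2))
      + m * (m + 1) * (ξ2 / k - R / h * (ε * (P * ξ0) + s * (Q * ξ1)) / (m + 1)) ^ 2
      + m / (m + 1) * (R / h) ^ 2 * ((P * ξ0 + σ * (Q * ξ1)) ^ 2
        - (ε * (P * ξ0) + s * (Q * ξ1)) ^ 2)
      + (R ^ 2 - R) / h ^ 2 * (σ ^ 2 - 1) * (- (Q * ξ1) ^ 2) := by
        rw [hL, hσ2]
        ring
    _ = _ := by
        have hm1 : m + 1 ≠ 0 := by positivity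
        field_simp
        ring

end Potential

section GaussianJensen

variable {E : Type*} [NormedAddCommGroup E] [InnerProductSpace ℝ E] [FiniteDimensional ℝ E]
  [MeasurableSpace E] [BorelSpace E]
  {ι : Type*} [Fintype ι]

open ProbabilityTheory in
lemma integral_id_stdGaussian_prod :
    ((ProbabilityTheory.stdGaussian E).prod (ProbabilityTheory.stdGaussian E))[id] = 0 := by
  have := FiniteDimensional.complete ℝ E
  set γ := ProbabilityTheory.stdGaussian E
  have h0 : ∫ x, x ∂γ = 0 := by simp [γ]
  have hi : Integrable (id : E → E) γ := IsGaussian.integrable_id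
  have hi2 : Integrable (id : E × E → E × E) (γ.prod γ) := (hi.comp_fst γ).prodMk (hi.comp_snd γ)
  ext1
  · rw [fst_integral hi2]
    simpa [h0] using integral_fun_fst (μ := γ) (ν := γ) (f := (id : E → E))
  · rw [snd_integral hi2]
    simpa [h0] using integral_fun_snd (μ := γ) (ν := γ) (f := (id : E → E))

open ProbabilityTheory in
/-- Jensen's inequality for functions of several jointly Gaussian vectors
`α i • x + β i • z`, with `x` and `z` independent and standard. -/
lemma jensen_stdGaussian {n : ℕ} {α β : ι → ℝ} (hαβ : ∀ i, 0 < α i ^ 2 + β i ^ 2)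
    {l r : ι → ℝ} (hlr : ∀ i, l i < r i) {Φ : (ι → ℝ) → ℝ} (hΦ : ContinuousOn Φ (Set.Icc l r))
    (hJ : ∀ l' r' : ι → ℝ, (∀ i, l i < l' i) → (∀ i, r' i < r i) →
      HasPosTaylor (fun i j => α i * α j + β i * β j) Φ (Set.Icc l' r'))
    {f : ι → Euc n → ℝ} (hf : ∀ i, Measurable (f i)) (hfm : ∀ i x, f i x ∈ Set.Icc (l i) (r i)) :
    Φ (fun i => ∫ x, f i (√(α i ^ 2 + β i ^ 2) • x) ∂(ProbabilityTheory.stdGaussian (Euc n)))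
      ≤ ∫ x, ∫ z, Φ (fun i => f i (α i • x + β i • z))
          ∂(ProbabilityTheory.stdGaussian (Euc n)) ∂(ProbabilityTheory.stdGaussian (Euc n)) := by
  set γ := ProbabilityTheory.stdGaussian (Euc n) with hγ
  have h := jensen_of_measurable (ν := γ.prod γ) (L := fun i => combo (Euc n) (α i) (β i))
    (integrable_one_add_norm_pow_three _)
    (map_sqrt_smul_add_prod integral_id_stdGaussian_prod) (fun i u => integral_inner_combo _ _ u)
    (fun i j u v => integral_inner_combo_mul_inner_combo _ _ _ _ u v)
    (fun i => map_combo_absolutelyContinuous n (hαβ i)) hlr hΦ hJ hf hfm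
  have hm : ∀ i, Measurable fun w : Euc n × Euc n => f i (α i • w.1 + β i • w.2) := fun i =>
    (hf i).comp (by fun_prop)
  have hmem : ∀ w : Euc n × Euc n, (fun i => f i (α i • w.1 + β i • w.2)) ∈ Set.Icc l r :=
    fun w => ⟨fun i => (hfm i _).1, fun i => (hfm i _).2⟩
  have hint : Integrable (fun w : Euc n × Euc n => Φ (fun i => f i (α i • w.1 + β i • w.2)))
      (γ.prod γ) :=
    integrable_comp_of_isCompact hΦ isCompact_Icc (measurable_pi_lambda _ hm) hmem
  simp only [combo_apply] at h
  rw [integral_prod _ hint] at h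
  refine le_trans (le_of_eq ?_) h
  congr 1
  ext i
  exact (integral_comp_combo (α i) (β i) (hf i)).symm

end GaussianJensen

section KeyInequality

lemma mem_interior_Icc_prod {P Q z : ℝ × ℝ} (h1 : P.1 < z.1) (h1' : z.1 < Q.1) (h2 : P.2 < z.2)
    (h2' : z.2 < Q.2) : z ∈ interior (Set.Icc P Q) := by
  rw [Set.Icc_prod_eq, interior_prod_eq, interior_Icc, interior_Icc]
  exact ⟨⟨h1, h1'⟩, ⟨h2, h2'⟩⟩

lemma exp_mul_log_sub_mul_log {R m h k : ℝ} (hh : 0 < h) (hk : 0 < k) :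
    Real.exp (R * Real.log h - m * Real.log k) = h ^ R * k ^ (-m) := by
  rw [Real.rpow_def_of_pos hh, Real.rpow_def_of_pos hk, ← Real.exp_add]
  ring_nf

/-- Jensen's inequality for the potential, in the form of an inequality between `R`-th moments. -/
lemma rpow_le_integral_rpow {n : ℕ} {P Q : ℝ × ℝ} (hPQ1 : P.1 < Q.1) (hPQ2 : P.2 < Q.2)
    {H : ℝ × ℝ → ℝ} (hH : ContDiffOn ℝ 3 H (Set.Icc P Q)) {δ : ℝ} (hδ : 0 < δ)
    (hHpos : ∀ z ∈ Set.Icc P Q, δ < H z) {R m : ℝ} (hR : 0 < R) (hm : 0 < m)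
    {α β : Fin 3 → ℝ} (hα2 : α 2 = 1) (hβ2 : β 2 = 0) (hαβ : ∀ i, 0 < α i ^ 2 + β i ^ 2)
    (hpos : ∀ x : Fin 3 → ℝ, (x 0, x 1) ∈ interior (Set.Icc P Q) → x 2 ≠ 0 → ∀ ξ : Fin 3 → ℝ,
      0 ≤ ∑ i, ∑ j, (α i * α j + β i * β j) * (potentialGrad H R m i x * potentialGrad H R m j x
        + potentialHess H R m i j x) * (ξ i * ξ j))
    {f g : Euc n → ℝ} (hf : Measurable f) (hg : Measurable g)
    (hfg : ∀ x y, (f x, g y) ∈ Set.Icc P Q) :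
    H (∫ x, f (√(α 0 ^ 2 + β 0 ^ 2) • x) ∂(ProbabilityTheory.stdGaussian (Euc n)),
        ∫ x, g (√(α 1 ^ 2 + β 1 ^ 2) • x) ∂(ProbabilityTheory.stdGaussian (Euc n)))
          ^ (R / (m + 1))
      ≤ ∫ x, (∫ z, H (f (α 0 • x + β 0 • z), g (α 1 • x + β 1 • z)) ^ R
          ∂(ProbabilityTheory.stdGaussian (Euc n))) ^ (1 / (m + 1))
        ∂(ProbabilityTheory.stdGaussian (Euc n)) := by
  set γ := ProbabilityTheory.stdGaussian (Euc n) with hγ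
  have hc : ContinuousOn H (Set.Icc P Q) := hH.continuousOn
  obtain ⟨M, hM⟩ := isCompact_Icc.exists_bound_of_continuousOn hc
  have hHM : ∀ z ∈ Set.Icc P Q, H z ≤ M := fun z hz => (le_abs_self _).trans (hM z hz)
  have hH0 : ∀ z ∈ Set.Icc P Q, 0 < H z := fun z hz => hδ.trans (hHpos z hz)
  have hfm : ∀ x, f x ∈ Set.Icc P.1 Q.1 := fun x => ⟨(hfg x 0).1.1, (hfg x 0).2.1⟩
  have hgm : ∀ x, g x ∈ Set.Icc P.2 Q.2 := fun x => ⟨(hfg 0 x).1.2, (hfg 0 x).2.2⟩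
  have hM0 : 0 < M := (hH0 _ (hfg 0 0)).trans_le (hHM _ (hfg 0 0))
  have hm1 : 0 < m + 1 := by linarith
  set V : Euc n × Euc n → ℝ := fun w =>
    H (f (α 0 • w.1 + β 0 • w.2), g (α 1 • w.1 + β 1 • w.2)) ^ R with hV
  have hVm : Measurable V := by
    refine (hc.measurable_comp_of_mem (F := fun w : Euc n × Euc n =>
      (f (α 0 • w.1 + β 0 • w.2), g (α 1 • w.1 + β 1 • w.2))) ?_ fun w => hfg _ _).pow_const R
    exact (hf.comp (by fun_prop)).prodMk (hg.comp (by fun_prop))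
  have hVmem : ∀ w, V w ∈ Set.Icc (δ ^ R) (M ^ R) := fun w =>
    ⟨Real.rpow_le_rpow hδ.le (hHpos _ (hfg _ _)).le hR.le,
      Real.rpow_le_rpow (hH0 _ (hfg _ _)).le (hHM _ (hfg _ _)) hR.le⟩
  set U : Euc n → ℝ := fun x => ∫ z, V (x, z) ∂γ with hU
  have hUm : Measurable U := (hVm.stronglyMeasurable.integral_prod_right (ν := γ)).measurable
  have hUmem : ∀ x, U x ∈ Set.Icc (δ ^ R) (M ^ R) := fun x =>
    integral_mem_Icc (hVm.comp measurable_prodMk_left) fun z => hVmem _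
  have hU0 : ∀ x, 0 < U x := fun x => (Real.rpow_pos_of_pos hδ R).trans_le (hUmem x).1
  set k : Euc n → ℝ := fun x => U x ^ (1 / (m + 1)) with hk
  have hkm : Measurable k := hUm.pow_const _
  set k₀ := (δ ^ R) ^ (1 / (m + 1)) with hk₀
  set k₁ := (M ^ R) ^ (1 / (m + 1)) + 1 with hk₁
  have hk₀0 : 0 < k₀ := by positivity
  have hkmem : ∀ x, k x ∈ Set.Icc k₀ k₁ := fun x =>
    ⟨Real.rpow_le_rpow (by positivity) (hUmem x).1 (by positivity),
      (Real.rpow_le_rpow (hU0 x).le (hUmem x).2 (by positivity)).trans (by rw [hk₁]; linarith)⟩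
  have hk0 : ∀ x, 0 < k x := fun x => hk₀0.trans_le (hkmem x).1
  have hk01 : k₀ < k₁ := by
    have h : δ ≤ M := (hHpos _ (hfg 0 0)).le.trans (hHM _ (hfg 0 0))
    have : k₀ ≤ (M ^ R) ^ (1 / (m + 1)) :=
      Real.rpow_le_rpow (by positivity) (Real.rpow_le_rpow hδ.le h hR.le) (by positivity)
    rw [hk₁]; linarith
  have hproj : ∀ x ∈ Set.Icc (![P.1, P.2, k₀] : Fin 3 → ℝ) ![Q.1, Q.2, k₁],
      (x 0, x 1) ∈ Set.Icc P Q ∧ k₀ ≤ x 2 := fun x hx =>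
    ⟨⟨⟨hx.1 0, hx.1 1⟩, ⟨hx.2 0, hx.2 1⟩⟩, hx.1 2⟩
  set Φ : (Fin 3 → ℝ) → ℝ := fun x =>
    Real.exp (R * Real.log (H (x 0, x 1)) - m * Real.log (x 2)) with hΦ
  have hΦc : ContinuousOn Φ (Set.Icc ![P.1, P.2, k₀] ![Q.1, Q.2, k₁]) := by
    have h1 : ContinuousOn (fun x : Fin 3 → ℝ => H (x 0, x 1))
        (Set.Icc ![P.1, P.2, k₀] ![Q.1, Q.2, k₁]) :=
      hc.comp (f := fun x : Fin 3 → ℝ => (x 0, x 1)) (by fun_prop) fun x hx => (hproj x hx).1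
    exact ((continuousOn_const.mul (h1.log fun x hx => (hH0 _ (hproj x hx).1).ne')).sub
      (continuousOn_const.mul (ContinuousOn.log (by fun_prop)
        fun x hx => (hk₀0.trans_le (hproj x hx).2).ne'))).rexp
  have hJ := jensen_stdGaussian (n := n) hαβ (l := ![P.1, P.2, k₀]) (r := ![Q.1, Q.2, k₁])
    (fun i => by fin_cases i; exacts [hPQ1, hPQ2, hk01]) hΦc (fun l' r' hl hr => by
      have hin : ∀ x ∈ Set.Icc l' r', (x 0, x 1) ∈ interior (Set.Icc P Q) := fun x hx =>
        mem_interior_Icc_prod ((hl 0).trans_le (hx.1 0)) ((hx.2 0).trans_lt (hr 0))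
          ((hl 1).trans_le (hx.1 1)) ((hx.2 1).trans_lt (hr 1))
      have hx2 : ∀ x ∈ Set.Icc l' r', x 2 ≠ 0 := fun x hx =>
        (hk₀0.trans ((hl 2).trans_le (hx.1 2))).ne'
      exact hasPosTaylor_exp_potential
        (fun x hx => hH.contDiffAt (mem_interior_iff_mem_nhds.1 (hin x hx)))
        (fun x hx => (hH0 _ (interior_subset (hin x hx))).ne') hx2
        fun x hx => hpos x (hin x hx) (hx2 x hx))
    (f := ![f, g, k]) (fun i => by fin_cases i; exacts [hf, hg, hkm])
    (fun i x => by fin_cases i; exacts [hfm x, hgm x, hkmem x])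
  have hEk : k₀ ≤ ∫ x, k x ∂γ := (integral_mem_Icc hkm hkmem).1
  have hEfg : (∫ x, f (√(α 0 ^ 2 + β 0 ^ 2) • x) ∂γ, ∫ x, g (√(α 1 ^ 2 + β 1 ^ 2) • x) ∂γ)
      ∈ Set.Icc P Q := by
    have h1 := integral_mem_Icc (μ := γ) (hf.comp (measurable_const_smul √(α 0 ^ 2 + β 0 ^ 2)))
      fun x => hfm _
    have h2 := integral_mem_Icc (μ := γ) (hg.comp (measurable_const_smul √(α 1 ^ 2 + β 1 ^ 2)))
      fun x => hgm _
    exact ⟨⟨h1.1, h2.1⟩, ⟨h1.2, h2.2⟩⟩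
  have hJl : ∀ x z : Euc n, Φ (fun i => ![f, g, k] i (α i • x + β i • z))
      = V (x, z) * k x ^ (-m) := fun x z => by
    simp only [hΦ, Matrix.cons_val, hα2, hβ2, one_smul, zero_smul, add_zero]
    exact exp_mul_log_sub_mul_log (hH0 _ (hfg _ _)) (hk0 x)
  have hkU : ∀ x, U x * k x ^ (-m) = k x := fun x => by
    rw [hk]
    dsimp only
    rw [← Real.rpow_mul (hU0 x).le]
    nth_rewrite 1 [← Real.rpow_one (U x)]
    rw [← Real.rpow_add (hU0 x)]
    congr 1
    field_simp
    ring
  have hint : ∫ x, ∫ z, Φ (fun i => ![f, g, k] i (α i • x + β i • z)) ∂γ ∂γ = ∫ x, k x ∂γ := by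
    simp only [hJl, integral_mul_const]
    exact integral_congr_ae (ae_of_all _ hkU)
  rw [← hγ, hint] at hJ
  set e := ∫ x, k x ∂γ with he
  have he0 : 0 < e := hk₀0.trans_le hEk
  simp only [hΦ, Matrix.cons_val, hα2, hβ2, one_pow, zero_pow two_ne_zero, add_zero,
    Real.sqrt_one, one_smul, ← he] at hJ
  set h := H (∫ x, f (√(α 0 ^ 2 + β 0 ^ 2) • x) ∂γ, ∫ x, g (√(α 1 ^ 2 + β 1 ^ 2) • x) ∂γ)
  have hh0 : 0 < h := hH0 _ hEfg
  rw [exp_mul_log_sub_mul_log hh0 he0, Real.rpow_neg he0.le,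
    ← div_eq_mul_inv, div_le_iff₀ (by positivity)] at hJ
  have h1 : h ^ R ≤ e ^ (m + 1) := by
    rwa [Real.rpow_add he0, Real.rpow_one, mul_comm]
  calc h ^ (R / (m + 1)) = (h ^ R) ^ (1 / (m + 1)) := by
        rw [← Real.rpow_mul hh0.le, mul_one_div]
    _ ≤ (e ^ (m + 1)) ^ (1 / (m + 1)) := Real.rpow_le_rpow (by positivity) h1 (by positivity)
    _ = e := by rw [← Real.rpow_mul he0.le, mul_one_div, div_self hm1.ne', Real.rpow_one]

end KeyInequality

section Parabolic

lemma abs_div_le_of_lt_abs {x y C d : ℝ} (hd : 0 < d) (hx : |x| ≤ C) (hy : d < |y|) :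
    |x / y| ≤ C / d := by
  rw [abs_div]
  exact div_le_div₀ ((abs_nonneg _).trans hx) hx hd hy.le

/-- The inequality for a fixed exponent `R`, with `s = ± 1` distinguishing `a = |1 - b|`
and `a = 1 + b`. -/
lemma rpow_le_integral_gammaPQX {n : ℕ} {P Q : ℝ × ℝ} (hPQ1 : P.1 < Q.1) (hPQ2 : P.2 < Q.2)
    {H : ℝ × ℝ → ℝ} (hH : ContDiffOn ℝ 3 H (Set.Icc P Q)) {δ : ℝ} (hδ : 0 < δ)
    (hHpos : ∀ z ∈ Set.Icc P Q, δ < H z)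
    (hHx : ∀ z ∈ interior (Set.Icc P Q), δ < |Hx H z|)
    (hHy : ∀ z ∈ interior (Set.Icc P Q), δ < |Hy H z|)
    {a b s : ℝ} (ha : 0 < a) (hb : 0 < b) (hs : s ^ 2 = 1) (hab : (1 - s * b) ^ 2 = a ^ 2)
    (hPDI : ∀ z ∈ interior (Set.Icc P Q),
      0 ≤ a ^ 2 * Hxx H z / (Hx H z) ^ 2
          + (1 - a ^ 2 - b ^ 2) * Hxy H z / (Hx H z * Hy H z)
          + b ^ 2 * Hyy H z / (Hy H z) ^ 2)
    {M C N : ℝ} (hM : ∀ z ∈ Set.Icc P Q, H z ≤ M)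
    (hC : ∀ z ∈ interior (Set.Icc P Q), |Hxx H z| ≤ C ∧ |Hxy H z| ≤ C ∧ |Hyy H z| ≤ C)
    (hN : N = M * (C / δ ^ 2 * (2 * a * (a + b) + 8)))
    {R m p q : ℝ} (hR : 0 < R) (hm : 0 < m) (hp : 1 ≤ p) (hq : q = -(s * b * p))
    (hκ0 : 0 < R / (m + 1) - 1) (hκ1 : R / (m + 1) - 1 ≤ 1)
    (hNp : 8 * N ≤ (R / (m + 1) - 1) * p)
    (hNS : N ^ 2 + a ^ 2 + 2 * N ≤ (R / (m + 1) - 1) * ((R - 1) / p))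
    {f g : Euc n → ℝ} (hf : Measurable f) (hg : Measurable g)
    (hfg : ∀ x y, (f x, g y) ∈ Set.Icc P Q) :
    H (∫ x, f (√(1 + 1 / (a ^ 2 * p)) • x) ∂(stdGaussian n),
        ∫ x, g (√(1 + 1 / (b ^ 2 * p)) • x) ∂(stdGaussian n)) ^ (R / (m + 1))
      ≤ ∫ x, (∫ y, H (f (a⁻¹ • (x - y)), g (b⁻¹ • y)) ^ R ∂(gammaPQX n p q x)) ^ (1 / (m + 1))
        ∂(stdGaussian n) := by
  have hp0 : 0 < p := by linarith
  set t := (√p)⁻¹ with ht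
  have ht2 : t ^ 2 = p⁻¹ := by rw [ht, inv_pow, Real.sq_sqrt hp0.le]
  set ε := (1 - s * b) / a with hε
  have hεa : ε * a = 1 - s * b := div_mul_cancel₀ _ ha.ne'
  have hε2 : ε ^ 2 = 1 := by rw [hε, div_pow, hab, div_self (by positivity)]
  have hσ2 : (ε * s) ^ 2 = 1 := by rw [mul_pow, hε2, hs, one_mul]
  have hσa : a * (ε * s) + b = s := by linear_combination s * hεa - b * hs
  have hσ1 : (a + ε * s * b) ^ 2 = 1 := by
    linear_combination (a * (ε * s) + b + s) * hσa + hs + (b ^ 2 - a ^ 2) * hσ2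
  have h2ab : 2 * a * b * (ε * s) = 1 - a ^ 2 - b ^ 2 := by
    linear_combination hσ1 - b ^ 2 * hσ2
  have hσabs : |ε * s| = 1 := by
    rw [← abs_one, ← sq_eq_sq_iff_abs_eq_abs, hσ2, one_pow]
  have e0 : ε ^ 2 + (-(t / a)) ^ 2 = 1 + 1 / (a ^ 2 * p) := by
    rw [hε2, neg_sq, div_pow, ht2]
    field_simp
  have e1 : s ^ 2 + (t / b) ^ 2 = 1 + 1 / (b ^ 2 * p) := by
    rw [hs, div_pow, ht2]
    field_simp
  have e01 : ε * s + -(t / a) * (t / b) = ε * s - 1 / (a * b * p) := by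
    have : -(t / a) * (t / b) = -(t ^ 2 / (a * b)) := by ring
    rw [this, ht2]
    field_simp
    ring
  have h := rpow_le_integral_rpow hPQ1 hPQ2 hH hδ hHpos hR hm (α := ![ε, s, 1])
    (β := ![-(t / a), t / b, 0]) rfl rfl (fun i => by
      fin_cases i
      · exact e0.symm ▸ (by positivity)
      · exact e1.symm ▸ (by positivity)
      · simp) (fun x hx hx2 => by
      have hHx' := hHx _ hx
      have hHy' := hHy _ hx
      have hxx : |Hxx H (x 0, x 1) / Hx H (x 0, x 1) ^ 2| ≤ C / δ ^ 2 :=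
        abs_div_le_of_lt_abs (by positivity) (hC _ hx).1 (by rw [abs_pow]; gcongr)
      have hxy : |Hxy H (x 0, x 1) / (Hx H (x 0, x 1) * Hy H (x 0, x 1))| ≤ C / δ ^ 2 :=
        abs_div_le_of_lt_abs (by positivity) (hC _ hx).2.1 (by rw [abs_mul, pow_two]; gcongr)
      have hyy : |Hyy H (x 0, x 1) / Hy H (x 0, x 1) ^ 2| ≤ C / δ ^ 2 :=
        abs_div_le_of_lt_abs (by positivity) (hC _ hx).2.2 (by rw [abs_pow]; gcongr)
      have hHz := hδ.trans (hHpos _ (interior_subset hx))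
      have hpde := hPDI _ hx
      rw [mul_div_assoc, mul_div_assoc, mul_div_assoc, ← h2ab] at hpde
      exact sum_potential_nonneg x hε2 hs rfl hR hm hp0.ne' ha.ne' hb.ne'
        (by simpa [pow_two] using e0) (by simpa using e01)
        (by simpa [mul_comm] using e01) (by simpa [pow_two] using e1) (by simp) (by simp)
        (by simp) (by simp) (by simp) hHz.ne' (abs_pos.1 (hδ.trans hHx'))
        (abs_pos.1 (hδ.trans hHy')) hx2
        (quadratic_nonneg ha hb hσ1 hσabs hHz (hM _ (interior_subset hx)) hxx hxy hyy hpde hκ0 hκ1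
          hp hN hNp hNS)) hf hg hfg
  simp only [Matrix.cons_val, e0, e1] at h
  rw [stdGaussian_eq]
  refine h.trans_eq (congrArg _ (funext fun x => congrArg (· ^ (1 / (m + 1))) ?_))
  rw [integral_gammaPQX hp0]
  refine congrArg _ (funext fun z => ?_)
  have hqp : -(q / p) = s * b := by rw [hq]; field_simp
  rw [hqp]
  congr 3
  · congr 1
    rw [hε, ← ht]
    match_scalars <;> field_simp
  · congr 1
    rw [← ht]
    match_scalars <;> field_simp

end Parabolic

/-- the key lemma in the parabolic case `a = |1−b|` or `a = 1+b`. -/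
theorem stmt4 (n : ℕ) (P Q : ℝ × ℝ) (hPQ1 : P.1 < Q.1) (hPQ2 : P.2 < Q.2)
    (H : ℝ × ℝ → ℝ) (hH : ContDiffOn ℝ 3 H (Set.Icc P Q))
    (δ : ℝ) (hδ : 0 < δ)
    (hHpos : ∀ z ∈ Set.Icc P Q, δ < H z)
    (hHx : ∀ z ∈ interior (Set.Icc P Q), δ < |Hx H z|)
    (hHy : ∀ z ∈ interior (Set.Icc P Q), δ < |Hy H z|)
    (a b : ℝ) (ha : 0 < a) (hb : 0 < b)
    (hab : a = |1 - b| ∨ a = 1 + b)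
    (hPDI : ∀ z ∈ interior (Set.Icc P Q),
      0 ≤ a ^ 2 * Hxx H z / (Hx H z) ^ 2
          + (1 - a ^ 2 - b ^ 2) * Hxy H z / (Hx H z * Hy H z)
          + b ^ 2 * Hyy H z / (Hy H z) ^ 2)
    (α β : ℝ) (hβ : 0 < β) (hβα : β < α) (hα : α < 1) (hαβ : 1 < α + β) :
    ∃ R₀ : ℝ, ∀ R : ℝ, R₀ < R → ∀ p q : ℝ, p = R ^ β →
      ((a = |1 - b| ∧ q = -b * R ^ β) ∨ (a = 1 + b ∧ q = b * R ^ β)) →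
      ∀ f g : Euc n → ℝ, Measurable f → Measurable g →
        (∀ x y, (f x, g y) ∈ Set.Icc P Q) →
        H (∫ x, f (Real.sqrt (1 + 1 / (a ^ 2 * R ^ β)) • x) ∂(stdGaussian n),
            ∫ x, g (Real.sqrt (1 + 1 / (b ^ 2 * R ^ β)) • x) ∂(stdGaussian n))
            ^ (R / (R - R ^ α)) ≤
          ∫ x, (∫ y, H (f (a⁻¹ • (x - y)), g (b⁻¹ • y)) ^ R ∂(gammaPQX n p q x))
              ^ (1 / (R - R ^ α)) ∂(stdGaussian n) := by
  have hK : IsCompact (Set.Icc P Q) := isCompact_Icc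
  have hint : (interior (Set.Icc P Q)).Nonempty :=
    ⟨((P.1 + Q.1) / 2, (P.2 + Q.2) / 2), mem_interior_Icc_prod
      (by dsimp; linarith) (by dsimp; linarith) (by dsimp; linarith) (by dsimp; linarith)⟩
  obtain ⟨C, hC⟩ := exists_bound_fderiv_fderiv hK (uniqueDiffOn_convex (convex_Icc P Q) hint)
    (hH.of_le (by norm_num))
  obtain ⟨M, hM⟩ := hK.bddAbove_image hH.continuousOn
  have h1 : ‖((1, 0) : ℝ × ℝ)‖ ≤ 1 := by simp
  have h2 : ‖((0, 1) : ℝ × ℝ)‖ ≤ 1 := by simp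
  have hM' : ∀ z ∈ Set.Icc P Q, H z ≤ M := fun z hz => hM (Set.mem_image_of_mem H hz)
  have hC' : ∀ z ∈ interior (Set.Icc P Q), |Hxx H z| ≤ C ∧ |Hxy H z| ≤ C ∧ |Hyy H z| ≤ C :=
    fun z hz => ⟨hC z hz _ _ h1 h1, hC z hz _ _ h1 h2, hC z hz _ _ h2 h2⟩
  set N := M * (C / δ ^ 2 * (2 * a * (a + b) + 8)) with hN
  obtain ⟨R₀, hR₀⟩ := eventually_atTop.1
    (eventually_exponent_bounds hβ hβα hα hαβ (max (8 * N) (N ^ 2 + a ^ 2 + 2 * N)))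
  refine ⟨R₀, fun R hR p q hp hq f g hf hg hfg => ?_⟩
  subst hp
  obtain ⟨hR2, hRβ, hRα, hB1, hB2⟩ := hR₀ R hR.le
  have hα0 : 0 < R ^ α := Real.rpow_pos_of_pos (by linarith) α
  have hm : R - R ^ α - 1 + 1 = R - R ^ α := by ring
  have hκ : R / (R - R ^ α - 1 + 1) - 1 = R ^ α / (R - R ^ α) := by
    rw [hm, div_sub_one (by linarith), sub_sub_cancel]
  obtain ⟨s, hs, hsab, hsq⟩ : ∃ s : ℝ, s ^ 2 = 1 ∧ (1 - s * b) ^ 2 = a ^ 2 ∧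
      q = -(s * b * R ^ β) := by
    rcases hq with ⟨rfl, rfl⟩ | ⟨rfl, rfl⟩
    · exact ⟨1, by norm_num, by rw [sq_abs, one_mul], by ring⟩
    · exact ⟨-1, by norm_num, by ring, by ring⟩
  have h := rpow_le_integral_gammaPQX hPQ1 hPQ2 hH hδ hHpos hHx hHy ha hb hs hsab hPDI hM' hC' hN
    (R := R) (m := R - R ^ α - 1) (by linarith) (by linarith) hRβ hsq
    (hκ ▸ div_pos hα0 (by linarith)) (hκ ▸ (div_le_one (by linarith)).2 (by linarith))
    (hκ ▸ (le_max_left _ _).trans hB1) (hκ ▸ (le_max_right _ _).trans hB2) hf hg hfg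
  rwa [hm] at h

end
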